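/- arXiv:2604.19183 — 6 statements merged into one kernel-verified Lean document; each statement's English description precedes it below -/
import Mathlib

section
/- For all integers s ≥ 1 and k, r ≥ 2 there exists a threshold n₀(k,s,r) such that for every n > n₀(k,s,r) and every r-graph H on [n] with matching number ν(H) < s (i.e., H contains no matching of size s), the (r-1,k)-norm satisfies ‖H‖_{r-1,k} ≤ ‖K(n,r,s)‖_{r-1,k}. Moreover, equality holds if and only if H consists of all r-subsets of [n] intersecting some fixed (s-1)-element subset of [n]. -/
open Finset

open scoped Classical

/-- `H` is an `r`-graph on the vertex set `[n] = {1, …, n}`. -/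
def IsRGraph (n r : ℕ) (H : Finset (Finset ℕ)) : Prop :=
  ∀ e ∈ H, e ⊆ Finset.Icc 1 n ∧ e.card = r

/-- The number of copies of the sunflower with `k` petals and core of size `t` in `H`:
families of `k` distinct hyperedges of `H` whose pairwise intersections all equal
a common `t`-element set. -/
noncomputable def sunCount (t k : ℕ) (H : Finset (Finset ℕ)) : ℕ :=
  ((H.powersetCard k).filter fun F => ∃ T : Finset ℕ, T.card = t ∧
    ∀ e ∈ F, ∀ f ∈ F, e ≠ f → e ∩ f = T).card

/-- The star `K(n,r,s)`: all `r`-subsets of `[n]` meeting `[s-1]`. -/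
def starGraph (n r s : ℕ) : Finset (Finset ℕ) :=
  ((Finset.Icc 1 n).powersetCard r).filter fun e => (e ∩ Finset.Icc 1 (s - 1)).Nonempty

/-- `H` contains a matching of size `s`, i.e. `s` pairwise disjoint hyperedges. -/
def HasMatching (H : Finset (Finset ℕ)) (s : ℕ) : Prop :=
  ∃ M ⊆ H, M.card = s ∧ ∀ e ∈ M, ∀ f ∈ M, e ≠ f → Disjoint e f

/-- The shifting operator `S_{ij}` applied to a hyperedge `e` of `H`. -/
def shiftEdge (H : Finset (Finset ℕ)) (i j : ℕ) (e : Finset ℕ) : Finset ℕ :=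
  if j ∈ e ∧ i ∉ e ∧ insert i (e.erase j) ∉ H then insert i (e.erase j) else e

/-- The shifted hypergraph `S_{ij}(H)`. -/
def shift (H : Finset (Finset ℕ)) (i j : ℕ) : Finset (Finset ℕ) :=
  H.image (shiftEdge H i j)

/-- `H` is shifted (stable): `S_{ij}(H) = H` for all `1 ≤ i < j ≤ n`. -/
def IsShifted (n : ℕ) (H : Finset (Finset ℕ)) : Prop :=
  ∀ i j : ℕ, 1 ≤ i → i < j → j ≤ n → shift H i j = H

/-- `H − {i}`: the hyperedges of `H` avoiding the vertex `i`. -/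
def deleteVertex (H : Finset (Finset ℕ)) (i : ℕ) : Finset (Finset ℕ) :=
  H.filter fun e => i ∉ e

/-- The link `L_i(H)` of the vertex `i`. -/
def link (H : Finset (Finset ℕ)) (i : ℕ) : Finset (Finset ℕ) :=
  (H.filter fun e => i ∈ e).image fun e => e.erase i

/-- The degree `d_H(T)`: the number of hyperedges of `H` containing `T`. -/
def degreeOf (H : Finset (Finset ℕ)) (T : Finset ℕ) : ℕ :=
  (H.filter fun e => T ⊆ e).card

/-- The `(t,k)`-norm of `H` on the vertex set `[n]`. -/
def normTK (n t k : ℕ) (H : Finset (Finset ℕ)) : ℕ :=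
  ∑ T ∈ (Finset.Icc 1 n).powersetCard t, (degreeOf H T) ^ k

section Degrees

variable {n m k s t : ℕ} {H G : Finset (Finset ℕ)} {A B S T : Finset ℕ}

/-- The `r`-subsets of `[n]` meeting `S`. -/
def starOn (n r : ℕ) (S : Finset ℕ) : Finset (Finset ℕ) :=
  ((Finset.Icc 1 n).powersetCard r).filter fun e => (e ∩ S).Nonempty

lemma mem_starOn {r : ℕ} {e : Finset ℕ} :
    e ∈ starOn n r S ↔ (e ⊆ Finset.Icc 1 n ∧ e.card = r) ∧ (e ∩ S).Nonempty := by
  simp [starOn, mem_powersetCard]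

lemma isRGraph_starOn (n r : ℕ) (S : Finset ℕ) : IsRGraph n r (starOn n r S) :=
  fun _ he => (mem_starOn.1 he).1

lemma IsRGraph.mono {r : ℕ} (hH : IsRGraph n r H) (h : G ⊆ H) : IsRGraph n r G :=
  fun e he => hH e (h he)

lemma HasMatching.mono (h : G ⊆ H) (hG : HasMatching G s) : HasMatching H s := by
  obtain ⟨M, hM, h'⟩ := hG
  exact ⟨M, hM.trans h, h'⟩

lemma degreeOf_mono (h : G ⊆ H) (T : Finset ℕ) : degreeOf G T ≤ degreeOf H T :=
  card_le_card (filter_subset_filter _ h)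

lemma normTK_mono (h : G ⊆ H) : normTK n t k G ≤ normTK n t k H :=
  sum_le_sum fun T _ => Nat.pow_le_pow_left (degreeOf_mono h T) k

lemma degreeOf_eq_card_filter_insert (hH : IsRGraph n (t + 1) H) (hT : T.card = t) :
    degreeOf H T = ((Finset.Icc 1 n \ T).filter fun x => insert x T ∈ H).card := by
  symm
  refine card_bij (fun x _ => insert x T) ?_ ?_ ?_
  · intro x hx
    simp only [mem_filter] at hx ⊢
    exact ⟨hx.2, subset_insert _ _⟩
  · intro x hx y hy hxy
    simp only [mem_filter, mem_sdiff] at hx hy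
    have : x ∈ insert y T := hxy ▸ mem_insert_self x T
    exact (mem_insert.1 this).resolve_right hx.1.2
  · intro e he
    simp only [mem_filter] at he
    obtain ⟨hen, hec⟩ := hH e he.1
    have h1 : (e \ T).card = 1 := by rw [card_sdiff_of_subset he.2]; omega
    obtain ⟨x, hx⟩ := card_eq_one.1 h1
    have hxe : x ∈ e \ T := by rw [hx]; simp
    have hins : insert x T = e := by
      rw [insert_eq, ← hx, sdiff_union_of_subset he.2]
    rw [mem_sdiff] at hxe
    refine ⟨x, ?_, hins⟩
    simp only [mem_filter, mem_sdiff]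
    exact ⟨⟨hen hxe.1, hxe.2⟩, hins ▸ he.1⟩

lemma card_Icc_sdiff (hT : T ⊆ Finset.Icc 1 n) (hTc : T.card = t) :
    (Finset.Icc 1 n \ T).card = n - t := by
  rw [card_sdiff_of_subset hT, Nat.card_Icc, hTc]; omega

lemma degreeOf_le (hH : IsRGraph n (t + 1) H) (hT : T ⊆ Finset.Icc 1 n) (hTc : T.card = t) :
    degreeOf H T ≤ n - t := by
  rw [degreeOf_eq_card_filter_insert hH hTc, ← card_Icc_sdiff hT hTc]
  exact card_filter_le _ _

lemma degreeOf_starOn_of_nonempty (hT : T ⊆ Finset.Icc 1 n) (hTc : T.card = t)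
    (h : (T ∩ S).Nonempty) : degreeOf (starOn n (t + 1) S) T = n - t := by
  rw [degreeOf_eq_card_filter_insert (isRGraph_starOn _ _ _) hTc, ← card_Icc_sdiff hT hTc,
    filter_true_of_mem]
  intro x hx
  rw [mem_sdiff] at hx
  refine mem_starOn.2 ⟨⟨insert_subset hx.1 hT, by rw [card_insert_of_notMem hx.2, hTc]⟩, ?_⟩
  exact h.mono (inter_subset_inter_right (subset_insert _ _))

lemma degreeOf_starOn_of_not_nonempty (hT : T ⊆ Finset.Icc 1 n) (hTc : T.card = t)
    (hS : S ⊆ Finset.Icc 1 n) (h : ¬ (T ∩ S).Nonempty) :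
    degreeOf (starOn n (t + 1) S) T = S.card := by
  rw [degreeOf_eq_card_filter_insert (isRGraph_starOn _ _ _) hTc]
  congr 1
  ext x
  simp only [mem_filter, mem_sdiff, mem_starOn]
  constructor
  · rintro ⟨⟨hx, hxT⟩, -, y, hy⟩
    rw [mem_inter, mem_insert] at hy
    rcases hy with ⟨rfl | hyT, hyS⟩
    · exact hyS
    · exact absurd ⟨y, mem_inter.2 ⟨hyT, hyS⟩⟩ h
  · intro hx
    have hxT : x ∉ T := fun hxT => h ⟨x, mem_inter.2 ⟨hxT, hx⟩⟩
    exact ⟨⟨hS hx, hxT⟩, ⟨insert_subset (hS hx) hT, by rw [card_insert_of_notMem hxT, hTc]⟩,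
      x, mem_inter.2 ⟨mem_insert_self _ _, hx⟩⟩

lemma filter_not_nonempty_inter (n t : ℕ) (S : Finset ℕ) :
    (((Finset.Icc 1 n).powersetCard t).filter fun T => ¬ (T ∩ S).Nonempty) =
      (Finset.Icc 1 n \ S).powersetCard t := by
  ext T
  simp only [mem_filter, mem_powersetCard, subset_sdiff, not_nonempty_iff_eq_empty,
    ← disjoint_iff_inter_eq_empty]
  tauto

lemma normTK_starOn (hS : S ⊆ Finset.Icc 1 n) :
    normTK n t k (starOn n (t + 1) S) =
      (n.choose t - (n - S.card).choose t) * (n - t) ^ k +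
        (n - S.card).choose t * S.card ^ k := by
  have hc : (((Finset.Icc 1 n).powersetCard t).filter fun T => ¬ (T ∩ S).Nonempty).card =
      (n - S.card).choose t := by
    rw [filter_not_nonempty_inter, card_powersetCard, card_sdiff_of_subset hS, Nat.card_Icc,
      Nat.add_sub_cancel]
  have hc' : (((Finset.Icc 1 n).powersetCard t).filter fun T => (T ∩ S).Nonempty).card =
      n.choose t - (n - S.card).choose t := by
    have := card_filter_add_card_filter_not (s := (Finset.Icc 1 n).powersetCard t)
      (fun T => (T ∩ S).Nonempty)
    rw [card_powersetCard, Nat.card_Icc, Nat.add_sub_cancel] at this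
    omega
  rw [normTK, ← sum_filter_add_sum_filter_not _ (fun T => (T ∩ S).Nonempty), ← hc', ← hc]
  congr 1
  · refine sum_const_nat fun T hT => ?_
    rw [mem_filter, mem_powersetCard] at hT
    rw [degreeOf_starOn_of_nonempty hT.1.1 hT.1.2 hT.2]
  · refine sum_const_nat fun T hT => ?_
    rw [mem_filter, mem_powersetCard] at hT
    rw [degreeOf_starOn_of_not_nonempty hT.1.1 hT.1.2 hS hT.2]

lemma normTK_starOn_congr {S' : Finset ℕ} (hS : S ⊆ Finset.Icc 1 n) (hS' : S' ⊆ Finset.Icc 1 n)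
    (h : S.card = S'.card) :
    normTK n t k (starOn n (t + 1) S) = normTK n t k (starOn n (t + 1) S') := by
  rw [normTK_starOn hS, normTK_starOn hS', h]

lemma normTK_lt_of_ssubset (hk : k ≠ 0) (hH : IsRGraph n (t + 1) H) (h : G ⊂ H) :
    normTK n t k G < normTK n t k H := by
  obtain ⟨e, heH, heG⟩ := exists_of_ssubset h
  obtain ⟨hen, hec⟩ := hH e heH
  obtain ⟨T, hTe, hTc⟩ := exists_subset_card_eq (show t ≤ e.card by omega)
  refine sum_lt_sum (fun T _ => Nat.pow_le_pow_left (degreeOf_mono h.1 T) k)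
    ⟨T, mem_powersetCard.2 ⟨hTe.trans hen, hTc⟩, Nat.pow_lt_pow_left ?_ hk⟩
  refine card_lt_card ((filter_subset_filter _ h.1).ssubset_of_ne fun heq => heG ?_)
  have : e ∈ G.filter fun e => T ⊆ e := by rw [heq]; exact mem_filter.2 ⟨heH, hTe⟩
  exact (mem_filter.1 this).1

lemma degreeOf_le_pow {r : ℕ} (hH : IsRGraph n r H) (A : Finset ℕ) :
    degreeOf H A ≤ n ^ (r - A.card) := by
  calc degreeOf H A ≤ ((Finset.Icc 1 n).powersetCard (r - A.card)).card := by
        refine card_le_card_of_injOn (fun e => e \ A) ?_ ?_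
        · intro e he
          obtain ⟨heH, hAe⟩ := mem_filter.1 (mem_coe.1 he)
          obtain ⟨hen, hec⟩ := hH e heH
          exact mem_coe.2 (mem_powersetCard.2
            ⟨sdiff_subset.trans hen, by rw [card_sdiff_of_subset hAe, hec]⟩)
        · intro e he f hf hef
          have hAe := (mem_filter.1 (mem_coe.1 he)).2
          have hAf := (mem_filter.1 (mem_coe.1 hf)).2
          rw [← sdiff_union_of_subset hAe, ← sdiff_union_of_subset hAf]
          exact congrArg (· ∪ A) hef
    _ ≤ n ^ (r - A.card) := by
        rw [card_powersetCard, Nat.card_Icc, Nat.add_sub_cancel]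
        exact Nat.choose_le_pow _ _

lemma sum_degreeOf_le (hH : IsRGraph n (t + 1) H) :
    ∑ T ∈ (Finset.Icc 1 n).powersetCard t, degreeOf H T ≤ (t + 1) * H.card := by
  have h : ∑ T ∈ (Finset.Icc 1 n).powersetCard t, degreeOf H T =
      ∑ e ∈ H, (((Finset.Icc 1 n).powersetCard t).filter fun T => T ⊆ e).card :=
    sum_card_bipartiteAbove_eq_sum_card_bipartiteBelow (fun T e : Finset ℕ => T ⊆ e)
  rw [h, mul_comm]
  refine sum_le_card_nsmul _ _ _ fun e he => ?_
  calc _ ≤ (e.powersetCard t).card := by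
        refine card_le_card fun T hT => ?_
        rw [mem_filter, mem_powersetCard] at hT
        exact mem_powersetCard.2 ⟨hT.2, hT.1.2⟩
    _ = t + 1 := by rw [card_powersetCard, (hH e he).2, Nat.choose_succ_self_right]

/-- Vertices of large degree can be covered one by one by disjoint hyperedges. -/
lemma hasMatching_of_large_degree (hH : IsRGraph n (m + 2) H) (B : Finset ℕ)
    (hB : ∀ v ∈ B, s * (m + 2) * n ^ m < degreeOf H {v}) :
    ∀ M ⊆ H, (∀ e ∈ M, ∀ f ∈ M, e ≠ f → Disjoint e f) → (∀ e ∈ M, Disjoint e B) →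
      M.card + B.card = s → HasMatching H s := by
  induction B using Finset.induction_on with
  | empty => exact fun M hM hd _ hc => ⟨M, hM, by simpa using hc, hd⟩
  | insert v B hv ih =>
    intro M hM hd hMB hc
    rw [card_insert_of_notMem hv] at hc
    have hvM : ∀ e ∈ M, v ∉ e := fun e he =>
      disjoint_right.1 (hMB e he) (mem_insert_self _ _)
    set X := B ∪ M.biUnion id with hX
    have hvX : v ∉ X := by
      simp only [hX, mem_union, mem_biUnion, id, not_or, not_exists, not_and]
      exact ⟨hv, hvM⟩
    have hXc : X.card ≤ s * (m + 2) := by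
      have h1 : (M.biUnion id).card ≤ M.card * (m + 2) :=
        card_biUnion_le_card_mul _ _ _ fun e he => (hH e (hM he)).2.le
      have h2 := card_union_le B (M.biUnion id)
      have h3 : B.card ≤ B.card * (m + 2) := Nat.le_mul_of_pos_right _ (by omega)
      have h4 : M.card * (m + 2) + B.card * (m + 2) ≤ s * (m + 2) := by
        rw [← add_mul]; exact Nat.mul_le_mul_right _ (by omega)
      rw [hX]
      omega
    obtain ⟨e, heH, hve, heX⟩ : ∃ e ∈ H, v ∈ e ∧ Disjoint e X := by
      by_contra! hcon
      have hsub : (H.filter fun e => {v} ⊆ e) ⊆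
          X.biUnion fun x => H.filter fun e => {v, x} ⊆ e := by
        intro e he
        obtain ⟨heH, hve⟩ := mem_filter.1 he
        obtain ⟨x, hxe, hxX⟩ := not_disjoint_iff.1 (hcon e heH (singleton_subset_iff.1 hve))
        refine mem_biUnion.2 ⟨x, hxX, mem_filter.2 ⟨heH, ?_⟩⟩
        exact insert_subset (singleton_subset_iff.1 hve) (singleton_subset_iff.2 hxe)
      have h1 : degreeOf H {v} ≤ X.card * n ^ m := by
        refine (card_le_card hsub).trans (card_biUnion_le_card_mul _ _ _ fun x hx => ?_)
        have := degreeOf_le_pow hH {v, x}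
        rwa [card_pair (ne_of_mem_of_not_mem hx hvX).symm, Nat.add_sub_cancel] at this
      have h2 := Nat.mul_le_mul_right (n ^ m) hXc
      have h3 := hB v (mem_insert_self _ _)
      omega
    have heM : ∀ f ∈ M, Disjoint e f := fun f hf =>
      heX.mono_right ((subset_biUnion_of_mem id hf).trans subset_union_right)
    have heM' : e ∉ M := fun h => hvM e h hve
    refine ih (fun w hw => hB w (mem_insert_of_mem hw)) (insert e M)
      (insert_subset heH hM) ?_ ?_ (by rw [card_insert_of_notMem heM']; omega)
    · intro f hf g hg hfg
      rw [mem_insert] at hf hg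
      rcases hf with rfl | hf <;> rcases hg with rfl | hg
      · exact absurd rfl hfg
      · exact heM g hg
      · exact (heM f hf).symm
      · exact hd f hf g hg hfg
    · intro f hf
      rcases mem_insert.1 hf with rfl | hf
      · exact heX.mono_right subset_union_left
      · exact (hMB f hf).mono_right (subset_insert _ _)

lemma hasMatching_or_exists_cover {r : ℕ} (hr : r ≠ 0) (hH : IsRGraph n r H) (s : ℕ) :
    HasMatching H s ∨ ∃ X : Finset ℕ, X.card ≤ s * r ∧ ∀ e ∈ H, ¬ Disjoint e X := by
  induction s with
  | zero => exact Or.inl ⟨∅, empty_subset _, rfl, by simp⟩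
  | succ s ih =>
    rcases ih with ⟨M, hM, hc, hd⟩ | ⟨X, hX, h⟩
    · by_cases hcov : ∀ e ∈ H, ¬ Disjoint e (M.biUnion id)
      · refine Or.inr ⟨_, ?_, hcov⟩
        calc (M.biUnion id).card ≤ M.card * r :=
              card_biUnion_le_card_mul _ _ _ fun e he => (hH e (hM he)).2.le
          _ ≤ (s + 1) * r := Nat.mul_le_mul_right _ (by omega)
      · push Not at hcov
        obtain ⟨e, heH, he⟩ := hcov
        have heM : ∀ f ∈ M, Disjoint e f := fun f hf =>
          he.mono_right (subset_biUnion_of_mem id hf)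
        have heM' : e ∉ M := fun h => by
          have h0 : e = ∅ := disjoint_self_iff_empty _ |>.1 (heM e h)
          have := (hH e heH).2
          rw [h0, card_empty] at this
          exact hr this.symm
        refine Or.inl ⟨insert e M, insert_subset heH hM, by rw [card_insert_of_notMem heM', hc], ?_⟩
        intro f hf g hg hfg
        rw [mem_insert] at hf hg
        rcases hf with rfl | hf <;> rcases hg with rfl | hg
        · exact absurd rfl hfg
        · exact heM g hg
        · exact (heM f hf).symm
        · exact hd f hf g hg hfg
    · exact Or.inr ⟨X, hX.trans (Nat.mul_le_mul_right _ (by omega)), h⟩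

lemma card_le_of_degreeOf_le {r D : ℕ} (hr : r ≠ 0) (hH : IsRGraph n r H)
    (hM : ¬ HasMatching H s) (hD : ∀ v, degreeOf H {v} ≤ D) : H.card ≤ s * r * D := by
  obtain ⟨X, hXc, hX⟩ := (hasMatching_or_exists_cover hr hH s).resolve_left hM
  have hsub : H ⊆ X.biUnion fun x => H.filter fun e => {x} ⊆ e := by
    intro e he
    obtain ⟨x, hxe, hxX⟩ := not_disjoint_iff.1 (hX e he)
    exact mem_biUnion.2 ⟨x, hxX, mem_filter.2 ⟨he, singleton_subset_iff.2 hxe⟩⟩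
  exact (card_le_card hsub).trans
    ((card_biUnion_le_card_mul _ _ _ fun x _ => hD x).trans (Nat.mul_le_mul_right _ hXc))

lemma degreeOf_le_card_add (hH : IsRGraph n (t + 1) H) (hTc : T.card = t)
    (hTB : ¬ (T ∩ B).Nonempty) :
    degreeOf H T ≤ B.card + degreeOf (H.filter fun e => Disjoint e B) T := by
  rw [degreeOf_eq_card_filter_insert hH hTc,
    degreeOf_eq_card_filter_insert (hH.mono (filter_subset _ _)) hTc]
  refine (card_le_card fun x hx => ?_).trans (card_union_le _ _)
  obtain ⟨hx, hxH⟩ := mem_filter.1 hx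
  by_cases hxB : x ∈ B
  · exact mem_union_left _ hxB
  · refine mem_union_right _ (mem_filter.2 ⟨hx, mem_filter.2 ⟨hxH, ?_⟩⟩)
    rw [disjoint_insert_left, disjoint_iff_inter_eq_empty]
    exact ⟨hxB, not_nonempty_iff_eq_empty.1 hTB⟩

lemma add_pow_succ_le (s d N j : ℕ) (hd : d ≤ N) :
    (s + d) ^ (j + 1) ≤ s ^ (j + 1) + (s + 1) ^ (j + 1) * N ^ j * d := by
  rcases Nat.eq_zero_or_pos d with rfl | hpos
  · simp
  · calc (s + d) ^ (j + 1) ≤ ((s + 1) * d) ^ (j + 1) := by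
          refine Nat.pow_le_pow_left ?_ _
          nlinarith
      _ = (s + 1) ^ (j + 1) * d ^ j * d := by rw [mul_pow, pow_succ d, mul_assoc]
      _ ≤ (s + 1) ^ (j + 1) * N ^ j * d := by gcongr
      _ ≤ _ := Nat.le_add_left _ _

lemma sum_degreeOf_pow_le {j : ℕ} (hj : 1 ≤ j) (hn : 1 ≤ n) (hH : IsRGraph n (m + 2) H)
    (hM : ¬ HasMatching H s) (hBs : B.card ≤ s)
    (hB : ∀ v, s * (m + 2) * n ^ m < degreeOf H {v} → v ∈ B) :
    ∑ T ∈ ((Finset.Icc 1 n).powersetCard (m + 1)).filter (fun T => ¬ (T ∩ B).Nonempty),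
      degreeOf H T ^ (j + 1) ≤
      (s ^ (j + 1) + (s + 1) ^ (j + 1) * ((m + 2) * (s * (m + 2)) ^ 2)) * n ^ (m + j) := by
  set G := H.filter fun e => Disjoint e B with hG
  have hGH : G ⊆ H := filter_subset _ _
  have hGr : IsRGraph n (m + 2) G := hH.mono hGH
  have hGc : G.card ≤ s * (m + 2) * (s * (m + 2) * n ^ m) := by
    refine card_le_of_degreeOf_le (by omega) hGr (fun h => hM (h.mono hGH)) fun v => ?_
    by_cases hv : v ∈ B
    · have : degreeOf G {v} = 0 := by
        refine card_eq_zero.2 (filter_eq_empty_iff.2 fun e he hve => ?_)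
        exact disjoint_left.1 (mem_filter.1 he).2 (singleton_subset_iff.1 hve) hv
      omega
    · exact (degreeOf_mono hGH _).trans (not_lt.1 fun h => hv (hB v h))
  calc _ ≤ ∑ T ∈ ((Finset.Icc 1 n).powersetCard (m + 1)).filter (fun T => ¬ (T ∩ B).Nonempty),
        (s ^ (j + 1) + (s + 1) ^ (j + 1) * n ^ j * degreeOf G T) := by
        refine sum_le_sum fun T hT => ?_
        rw [mem_filter, mem_powersetCard] at hT
        refine (Nat.pow_le_pow_left ?_ _).trans (add_pow_succ_le s (degreeOf G T) n j
          ((degreeOf_le hGr hT.1.1 hT.1.2).trans (Nat.sub_le _ _)))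
        exact (degreeOf_le_card_add hH hT.1.2 hT.2).trans (Nat.add_le_add_right hBs _)
    _ ≤ ∑ T ∈ (Finset.Icc 1 n).powersetCard (m + 1),
        (s ^ (j + 1) + (s + 1) ^ (j + 1) * n ^ j * degreeOf G T) :=
        sum_le_sum_of_subset (filter_subset _ _)
    _ = n.choose (m + 1) * s ^ (j + 1) + (s + 1) ^ (j + 1) * n ^ j *
          ∑ T ∈ (Finset.Icc 1 n).powersetCard (m + 1), degreeOf G T := by
        rw [sum_add_distrib, sum_const, card_powersetCard, Nat.card_Icc, Nat.add_sub_cancel,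
          smul_eq_mul, ← mul_sum]
    _ ≤ n ^ (m + j) * s ^ (j + 1) + (s + 1) ^ (j + 1) * n ^ j *
          ((m + 2) * (s * (m + 2) * (s * (m + 2) * n ^ m))) := by
        gcongr
        · exact (Nat.choose_le_pow _ _).trans (Nat.pow_le_pow_right hn (by omega))
        · exact (sum_degreeOf_le hGr).trans (Nat.mul_le_mul_left _ hGc)
    _ = _ := by ring

lemma choose_mul_pow_le_sum {v : ℕ} (hS : S ⊆ Finset.Icc 1 n) (hBS : B ⊆ S) (hvS : v ∈ S)
    (hvB : v ∉ B) :
    (n - S.card).choose m * (n - (m + 1)) ^ k ≤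
      ∑ T ∈ ((Finset.Icc 1 n).powersetCard (m + 1)).filter (fun T => ¬ (T ∩ B).Nonempty),
        degreeOf (starOn n (m + 2) S) T ^ k := by
  have hc : ((Finset.Icc 1 n \ S).powersetCard m).card = (n - S.card).choose m := by
    rw [card_powersetCard, card_sdiff_of_subset hS, Nat.card_Icc, Nat.add_sub_cancel]
  have hprop : ∀ U ∈ (Finset.Icc 1 n \ S).powersetCard m, v ∉ U ∧
      insert v U ⊆ Finset.Icc 1 n ∧ (insert v U).card = m + 1 ∧ ¬ (insert v U ∩ B).Nonempty := by
    intro U hU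
    rw [mem_powersetCard, subset_sdiff] at hU
    have hvU : v ∉ U := disjoint_right.1 hU.1.2 hvS
    refine ⟨hvU, insert_subset (hS hvS) hU.1.1, by rw [card_insert_of_notMem hvU, hU.2], ?_⟩
    rw [not_nonempty_iff_eq_empty, ← disjoint_iff_inter_eq_empty, disjoint_insert_left]
    exact ⟨hvB, hU.1.2.mono_right hBS⟩
  have hinj : Set.InjOn (fun U => insert v U)
      ((Finset.Icc 1 n \ S).powersetCard m : Set (Finset ℕ)) := by
    intro U hU W hW h
    rw [← erase_insert (hprop U hU).1, ← erase_insert (hprop W hW).1]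
    exact congrArg (fun A => Finset.erase A v) h
  rw [← hc, ← card_image_of_injOn hinj]
  calc _ = ∑ T ∈ ((Finset.Icc 1 n \ S).powersetCard m).image (fun U => insert v U),
        degreeOf (starOn n (m + 2) S) T ^ k := by
        symm
        refine sum_const_nat fun T hT => ?_
        obtain ⟨U, hU, rfl⟩ := mem_image.1 hT
        obtain ⟨-, h1, h2, -⟩ := hprop U hU
        rw [degreeOf_starOn_of_nonempty h1 h2 ⟨v, mem_inter.2 ⟨mem_insert_self _ _, hvS⟩⟩]
    _ ≤ _ := by
        refine sum_le_sum_of_subset fun T hT => ?_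
        obtain ⟨U, hU, rfl⟩ := mem_image.1 hT
        obtain ⟨-, h1, h2, h3⟩ := hprop U hU
        exact mem_filter.2 ⟨mem_powersetCard.2 ⟨h1, h2⟩, h3⟩

lemma mul_pow_lt_choose_mul_pow {b j C : ℕ} (hn : 2 * (b + m + 1) ≤ n)
    (hC : 2 ^ (m + (j + 1)) * m.factorial * C < n) :
    C * n ^ (m + j) < (n - b).choose m * (n - (m + 1)) ^ (j + 1) := by
  have h1 : n ^ m ≤ 2 ^ m * (m.factorial * (n - b).choose m) := by
    have h : (n - b + 1 - m) ^ m ≤ m.factorial * (n - b).choose m := by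
      rw [← Nat.descFactorial_eq_factorial_mul_choose]
      exact Nat.pow_sub_le_descFactorial _ _
    calc n ^ m ≤ (2 * (n - b + 1 - m)) ^ m := Nat.pow_le_pow_left (by omega) _
      _ = 2 ^ m * (n - b + 1 - m) ^ m := mul_pow _ _ _
      _ ≤ _ := Nat.mul_le_mul_left _ h
  have h2 : n ^ (j + 1) ≤ 2 ^ (j + 1) * (n - (m + 1)) ^ (j + 1) := by
    rw [← mul_pow]
    exact Nat.pow_le_pow_left (by omega) _
  have hpos : 0 < 2 ^ (m + (j + 1)) * m.factorial := by positivity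
  refine lt_of_mul_lt_mul_left ?_ hpos.le
  calc 2 ^ (m + (j + 1)) * m.factorial * (C * n ^ (m + j))
      = 2 ^ (m + (j + 1)) * m.factorial * C * n ^ (m + j) := by ring
    _ < n * n ^ (m + j) := Nat.mul_lt_mul_of_pos_right hC (Nat.pow_pos (by omega))
    _ = n ^ m * n ^ (j + 1) := by ring
    _ ≤ 2 ^ m * (m.factorial * (n - b).choose m) * (2 ^ (j + 1) * (n - (m + 1)) ^ (j + 1)) :=
        Nat.mul_le_mul h1 h2
    _ = _ := by ring

lemma normTK_lt_of_card_lt {j : ℕ} (hj : 1 ≤ j) (hH : IsRGraph n (m + 2) H)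
    (hM : ¬ HasMatching H s) (hBS : B ⊂ S) (hS : S ⊆ Finset.Icc 1 n) (hSs : S.card ≤ s)
    (hB : ∀ v, s * (m + 2) * n ^ m < degreeOf H {v} → v ∈ B)
    (hn : 2 * (s + m + 1) ≤ n)
    (hC : 2 ^ (m + (j + 1)) * m.factorial *
      (s ^ (j + 1) + (s + 1) ^ (j + 1) * ((m + 2) * (s * (m + 2)) ^ 2)) < n) :
    normTK n (m + 1) (j + 1) H < normTK n (m + 1) (j + 1) (starOn n (m + 2) S) := by
  obtain ⟨v, hvS, hvB⟩ := exists_of_ssubset hBS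
  rw [normTK, normTK, ← sum_filter_add_sum_filter_not _ (fun T => (T ∩ B).Nonempty),
    ← sum_filter_add_sum_filter_not ((Finset.Icc 1 n).powersetCard (m + 1))
      (fun T => (T ∩ B).Nonempty) (fun T => degreeOf (starOn n (m + 2) S) T ^ (j + 1))]
  refine add_lt_add_of_le_of_lt (sum_le_sum fun T hT => Nat.pow_le_pow_left ?_ _) ?_
  · rw [mem_filter, mem_powersetCard] at hT
    rw [degreeOf_starOn_of_nonempty hT.1.1 hT.1.2
      (hT.2.mono (inter_subset_inter_left hBS.1))]
    exact degreeOf_le hH hT.1.1 hT.1.2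
  · exact (sum_degreeOf_pow_le hj (by omega) hH hM ((card_le_card hBS.1).trans hSs) hB).trans_lt
      ((mul_pow_lt_choose_mul_pow (by omega) hC).trans_le
        (choose_mul_pow_le_sum hS hBS.1 hvS hvB))

/-- Either `H` is contained in a star, or its norm is strictly below that of a star. -/
lemma exists_subset_starOn_or_normTK_lt {j : ℕ} (hj : 1 ≤ j) (hH : IsRGraph n (m + 2) H)
    (hM : ¬ HasMatching H (s + 1))
    (hn : 2 * (s + 1 + m + 1) ≤ n)
    (hC : 2 ^ (m + (j + 1)) * m.factorial * ((s + 1) ^ (j + 1) +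
      (s + 1 + 1) ^ (j + 1) * ((m + 2) * ((s + 1) * (m + 2)) ^ 2)) < n) :
    ∃ S ⊆ Finset.Icc 1 n, S.card = s ∧ (H ⊆ starOn n (m + 2) S ∨
      normTK n (m + 1) (j + 1) H < normTK n (m + 1) (j + 1) (starOn n (m + 2) S)) := by
  set B := (Finset.Icc 1 n).filter fun v => (s + 1) * (m + 2) * n ^ m < degreeOf H {v} with hBdef
  have hBn : B ⊆ Finset.Icc 1 n := filter_subset _ _
  have hB : ∀ v ∈ B, (s + 1) * (m + 2) * n ^ m < degreeOf H {v} := fun v hv => (mem_filter.1 hv).2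
  have hB' : ∀ v, (s + 1) * (m + 2) * n ^ m < degreeOf H {v} → v ∈ B := by
    intro v hv
    refine mem_filter.2 ⟨?_, hv⟩
    obtain ⟨e, he⟩ := card_pos.1 (Nat.zero_lt_of_lt hv)
    obtain ⟨heH, hve⟩ := mem_filter.1 he
    exact (hH e heH).1 (singleton_subset_iff.1 hve)
  have hBs : B.card ≤ s := by
    by_contra! hcon
    obtain ⟨B', hB'B, hB'c⟩ := exists_subset_card_eq (Nat.succ_le_of_lt hcon)
    exact hM (hasMatching_of_large_degree hH B' (fun v hv => hB v (hB'B hv)) ∅ (empty_subset _)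
      (by simp) (by simp) (by simpa using hB'c))
  rcases hBs.eq_or_lt with hBc | hBc
  · refine ⟨B, hBn, hBc, Or.inl fun e he => mem_starOn.2 ⟨hH e he, ?_⟩⟩
    by_contra hcon
    rw [not_nonempty_iff_eq_empty, ← disjoint_iff_inter_eq_empty] at hcon
    refine hM (hasMatching_of_large_degree hH B hB {e} (singleton_subset_iff.2 he) ?_ ?_ ?_)
    · intro f hf g hg hfg
      rw [mem_singleton] at hf hg
      exact absurd (hf.trans hg.symm) hfg
    · intro f hf
      rw [mem_singleton.1 hf]
      exact hcon
    · rw [card_singleton, hBc, add_comm]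
  · obtain ⟨S, hBS, hSn, hSc⟩ := exists_subsuperset_card_eq hBn hBs
      (show s ≤ (Finset.Icc 1 n).card by rw [Nat.card_Icc]; omega)
    refine ⟨S, hSn, hSc, Or.inr (normTK_lt_of_card_lt hj hH hM
      (hBS.ssubset_of_ne fun h => ?_) hSn (by omega) hB' hn hC)⟩
    rw [h, hSc] at hBc
    exact lt_irrefl _ hBc

end Degrees

theorem EMC_in_norm (k s r : ℕ) (hs : 1 ≤ s) (hk : 2 ≤ k) (hr : 2 ≤ r) :
    ∃ n₀ : ℕ, ∀ n : ℕ, n > n₀ → ∀ H : Finset (Finset ℕ), IsRGraph n r H →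
      ¬ HasMatching H s →
      normTK n (r - 1) k H ≤ normTK n (r - 1) k (starGraph n r s) ∧
      (normTK n (r - 1) k H = normTK n (r - 1) k (starGraph n r s) ↔
        ∃ S : Finset ℕ, S ⊆ Finset.Icc 1 n ∧ S.card = s - 1 ∧
          H = ((Finset.Icc 1 n).powersetCard r).filter fun e => (e ∩ S).Nonempty) := by
  obtain ⟨s, rfl⟩ := Nat.exists_eq_add_of_le' hs
  obtain ⟨m, rfl⟩ := Nat.exists_eq_add_of_le' hr
  obtain ⟨j, rfl⟩ : ∃ j, k = j + 1 := ⟨k - 1, by omega⟩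
  refine ⟨2 * (s + 1 + m + 1) + 2 ^ (m + (j + 1)) * m.factorial * ((s + 1) ^ (j + 1) +
      (s + 1 + 1) ^ (j + 1) * ((m + 2) * ((s + 1) * (m + 2)) ^ 2)), fun n hn H hH hM => ?_⟩
  have hstar : starGraph n (m + 2) (s + 1) = starOn n (m + 2) (Finset.Icc 1 s) := rfl
  have hIcc : Finset.Icc 1 s ⊆ Finset.Icc 1 n := Finset.Icc_subset_Icc_right (by omega)
  have heq : ∀ S ⊆ Finset.Icc 1 n, S.card = s →
      normTK n (m + 1) (j + 1) (starOn n (m + 2) S) =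
        normTK n (m + 1) (j + 1) (starOn n (m + 2) (Finset.Icc 1 s)) :=
    fun S hS hSc => normTK_starOn_congr hS hIcc (by rw [hSc, Nat.card_Icc, Nat.add_sub_cancel])
  obtain ⟨S, hS, hSc, hcase⟩ := exists_subset_starOn_or_normTK_lt (show 1 ≤ j by omega) hH hM
    (by omega) (by omega)
  rw [hstar, show m + 2 - 1 = m + 1 from rfl, Nat.add_sub_cancel, ← heq S hS hSc]
  refine ⟨hcase.elim normTK_mono le_of_lt, fun h => ⟨S, hS, hSc, ?_⟩, ?_⟩
  · rcases hcase with hsub | hlt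
    · by_contra hne
      exact (normTK_lt_of_ssubset (by omega) (isRGraph_starOn _ _ _)
        (hsub.ssubset_of_ne hne)).ne h
    · exact absurd h hlt.ne
  · rintro ⟨S', hS', hSc', rfl⟩
    exact (heq S' hS' hSc').trans (heq S hS hSc).symm
end

section
/- Let k ≥ 1, let H be an r-graph on [n] with r ≥ 2, and let 1 ≤ i < j ≤ n. Then the shifting operation does not decrease the number of copies of the sunflower S_{r-1,k}^r: N(S_{r-1,k}^r, S_{ij}(H)) ≥ N(S_{r-1,k}^r, H). -/
open Finset

open scoped Classical

/-- The image of `e` under the transposition of `i` and `j`. -/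
def swapSet (i j : ℕ) (e : Finset ℕ) : Finset ℕ :=
  e.map (Equiv.swap i j).toEmbedding

theorem mem_swapSet {i j x : ℕ} {e : Finset ℕ} :
    x ∈ swapSet i j e ↔ Equiv.swap i j x ∈ e := by
  simp [swapSet, Finset.mem_map_equiv]

theorem swapSet_swapSet (i j : ℕ) (e : Finset ℕ) : swapSet i j (swapSet i j e) = e := by
  ext x
  simp [mem_swapSet]

theorem swapSet_injective (i j : ℕ) : Function.Injective (swapSet i j) :=
  Function.LeftInverse.injective (swapSet_swapSet i j)

theorem left_mem_swapSet {i j : ℕ} {e : Finset ℕ} : i ∈ swapSet i j e ↔ j ∈ e := by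
  simp [mem_swapSet]

theorem right_mem_swapSet {i j : ℕ} {e : Finset ℕ} : j ∈ swapSet i j e ↔ i ∈ e := by
  simp [mem_swapSet]

theorem swapSet_eq_self {i j : ℕ} {e : Finset ℕ} (h : i ∈ e ↔ j ∈ e) : swapSet i j e = e := by
  ext x
  rw [mem_swapSet, Equiv.swap_apply_def]
  split_ifs with h1 h2 <;> simp_all

theorem swapSet_subset_swapSet {i j : ℕ} {e f : Finset ℕ} :
    swapSet i j e ⊆ swapSet i j f ↔ e ⊆ f :=
  Finset.map_subset_map

theorem subset_swapSet {i j : ℕ} {e f : Finset ℕ} : e ⊆ swapSet i j f ↔ swapSet i j e ⊆ f := by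
  rw [← swapSet_subset_swapSet (i := i) (j := j) (e := e), swapSet_swapSet]

theorem card_swapSet (i j : ℕ) (e : Finset ℕ) : (swapSet i j e).card = e.card :=
  Finset.card_map _

theorem insert_erase_eq_swapSet {i j : ℕ} {e : Finset ℕ} (hj : j ∈ e) (hi : i ∉ e) :
    insert i (e.erase j) = swapSet i j e := by
  ext x
  rw [mem_swapSet, Equiv.swap_apply_def]
  split_ifs with h1 h2
  · simp_all
  · subst h2
    simp_all
  · simp_all

theorem shiftEdge_eq (H : Finset (Finset ℕ)) (i j : ℕ) (e : Finset ℕ) :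
    shiftEdge H i j e =
      if j ∈ e ∧ i ∉ e ∧ swapSet i j e ∉ H then swapSet i j e else e := by
  unfold shiftEdge
  by_cases h : j ∈ e ∧ i ∉ e
  · rw [insert_erase_eq_swapSet h.1 h.2]
  · rw [if_neg (by tauto), if_neg (by tauto)]

theorem shiftEdge_injOn (H : Finset (Finset ℕ)) (i j : ℕ) :
    Set.InjOn (shiftEdge H i j) (H : Set (Finset ℕ)) := by
  intro e he f hf h
  rw [Finset.mem_coe] at he hf
  rw [shiftEdge_eq, shiftEdge_eq] at h
  split_ifs at h with h1 h2 h2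
  · exact swapSet_injective i j h
  · exact absurd (h ▸ hf) h1.2.2
  · exact absurd (h ▸ he) h2.2.2
  · exact h

theorem mem_shift {H : Finset (Finset ℕ)} {i j : ℕ} {e : Finset ℕ} :
    e ∈ shift H i j ↔ if i ∈ e then e ∈ H ∨ j ∉ e ∧ swapSet i j e ∈ H
      else e ∈ H ∧ (j ∈ e → swapSet i j e ∈ H) := by
  unfold shift
  rw [Finset.mem_image]
  constructor
  · rintro ⟨f, hf, rfl⟩
    rw [shiftEdge_eq]
    by_cases h : j ∈ f ∧ i ∉ f ∧ swapSet i j f ∉ H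
    · simp [h, left_mem_swapSet, right_mem_swapSet, swapSet_swapSet, hf]
    · rw [if_neg h]
      split_ifs <;> tauto
  · intro h
    by_cases he : e ∈ H ∧ (j ∈ e → i ∉ e → swapSet i j e ∈ H)
    · exact ⟨e, he.1, by rw [shiftEdge_eq, if_neg (by tauto)]⟩
    · split_ifs at h with hi
      · refine ⟨swapSet i j e, by tauto, ?_⟩
        rw [shiftEdge_eq, swapSet_swapSet, if_pos]
        rw [left_mem_swapSet, right_mem_swapSet]
        tauto
      · tauto

theorem card_shift (H : Finset (Finset ℕ)) (i j : ℕ) : (shift H i j).card = H.card :=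
  Finset.card_image_of_injOn (shiftEdge_injOn H i j)

theorem swapSet_subset_Icc {n i j : ℕ} (hi : i ∈ Finset.Icc 1 n) (hj : j ∈ Finset.Icc 1 n)
    {e : Finset ℕ} (he : e ⊆ Finset.Icc 1 n) : swapSet i j e ⊆ Finset.Icc 1 n := by
  rw [← swapSet_eq_self (iff_of_true hi hj), swapSet_subset_swapSet]
  exact he

theorem IsRGraph.shift {n r i j : ℕ} {H : Finset (Finset ℕ)} (hH : IsRGraph n r H)
    (hi : i ∈ Finset.Icc 1 n) (hj : j ∈ Finset.Icc 1 n) : IsRGraph n r (shift H i j) := by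
  intro e he
  obtain ⟨f, hf, rfl⟩ := Finset.mem_image.1 he
  rw [shiftEdge_eq]
  split_ifs
  · exact ⟨swapSet_subset_Icc hi hj (hH f hf).1, (card_swapSet i j f).trans (hH f hf).2⟩
  · exact hH f hf

theorem choose_card_add_choose_card_le {α : Type*} [DecidableEq α] (A B : Finset α) (k : ℕ) :
    A.card.choose k + B.card.choose k ≤ (A ∪ B).card.choose k + (A ∩ B).card.choose k := by
  simp only [← Finset.card_powersetCard]
  rw [← Finset.card_union_add_card_inter]
  refine Nat.add_le_add (Finset.card_le_card ?_) (Finset.card_le_card ?_)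
  · exact Finset.union_subset (Finset.powersetCard_mono Finset.subset_union_left)
      (Finset.powersetCard_mono Finset.subset_union_right)
  · intro F hF
    simp only [Finset.mem_inter, Finset.mem_powersetCard] at hF ⊢
    exact ⟨Finset.subset_inter hF.1.1 hF.2.1, hF.1.2⟩

theorem degreeOf_shift_of_iff (H : Finset (Finset ℕ)) {i j : ℕ} {T : Finset ℕ}
    (hT : i ∈ T ↔ j ∈ T) : degreeOf (shift H i j) T = degreeOf H T := by
  have key : ∀ e, T ⊆ shiftEdge H i j e ↔ T ⊆ e := by
    intro e
    rw [shiftEdge_eq]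
    split_ifs
    · rw [subset_swapSet, swapSet_eq_self hT]
    · rfl
  unfold degreeOf shift
  rw [Finset.filter_image]
  simp only [key]
  exact Finset.card_image_of_injOn
    ((shiftEdge_injOn H i j).mono (Finset.coe_subset.2 (Finset.filter_subset _ _)))

theorem degreeOf_swapSet (H : Finset (Finset ℕ)) (i j : ℕ) (T : Finset ℕ) :
    degreeOf H (swapSet i j T) = degreeOf (H.image (swapSet i j)) T := by
  unfold degreeOf
  rw [Finset.filter_image, Finset.card_image_of_injective _ (swapSet_injective i j)]
  simp only [subset_swapSet]

theorem mem_image_swapSet {H : Finset (Finset ℕ)} {i j : ℕ} {e : Finset ℕ} :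
    e ∈ H.image (swapSet i j) ↔ swapSet i j e ∈ H := by
  rw [Finset.mem_image]
  constructor
  · rintro ⟨f, hf, rfl⟩
    rwa [swapSet_swapSet]
  · exact fun h => ⟨_, h, swapSet_swapSet i j e⟩

theorem choose_degreeOf_le_of_mem (H : Finset (Finset ℕ)) {i j : ℕ} (k : ℕ) {T : Finset ℕ}
    (hi : i ∈ T) :
    (degreeOf H T).choose k + (degreeOf H (swapSet i j T)).choose k ≤
      (degreeOf (shift H i j) T).choose k +
        (degreeOf (shift H i j) (swapSet i j T)).choose k := by
  rw [degreeOf_swapSet, degreeOf_swapSet]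
  have union_eq : (shift H i j).filter (T ⊆ ·) =
      H.filter (T ⊆ ·) ∪ (H.image (swapSet i j)).filter (T ⊆ ·) := by
    ext e
    simp only [Finset.mem_union, Finset.mem_filter, mem_shift, mem_image_swapSet]
    by_cases hT : T ⊆ e
    · by_cases hj : j ∈ e
      · simp [hT, hT hi, hj, swapSet_eq_self (iff_of_true (hT hi) hj)]
      · simp [hT, hT hi, hj]
    · simp [hT]
  have inter_eq : ((shift H i j).image (swapSet i j)).filter (T ⊆ ·) =
      H.filter (T ⊆ ·) ∩ (H.image (swapSet i j)).filter (T ⊆ ·) := by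
    ext e
    simp only [Finset.mem_inter, Finset.mem_filter, mem_shift, mem_image_swapSet,
      left_mem_swapSet, right_mem_swapSet, swapSet_swapSet]
    by_cases hT : T ⊆ e
    · by_cases hj : j ∈ e
      · simp [hT, hT hi, hj, swapSet_eq_self (iff_of_true (hT hi) hj)]
      · simp [hT, hT hi, hj, and_comm]
    · simp [hT]
  unfold degreeOf
  rw [union_eq, inter_eq]
  exact choose_card_add_choose_card_le _ _ k

theorem choose_degreeOf_le (H : Finset (Finset ℕ)) (i j k : ℕ) (T : Finset ℕ) :
    (degreeOf H T).choose k + (degreeOf H (swapSet i j T)).choose k ≤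
      (degreeOf (shift H i j) T).choose k +
        (degreeOf (shift H i j) (swapSet i j T)).choose k := by
  by_cases hT : i ∈ T ↔ j ∈ T
  · rw [swapSet_eq_self hT, degreeOf_shift_of_iff H hT]
  · by_cases hi : i ∈ T
    · exact choose_degreeOf_le_of_mem H k hi
    · have := choose_degreeOf_le_of_mem (j := j) H k
        (left_mem_swapSet.2 (by tauto : j ∈ T) : i ∈ swapSet i j T)
      rw [swapSet_swapSet] at this
      omega

theorem sum_choose_degreeOf_le (H : Finset (Finset ℕ)) {n i j : ℕ} (t k : ℕ)
    (hi : i ∈ Finset.Icc 1 n) (hj : j ∈ Finset.Icc 1 n) :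
    ∑ T ∈ (Finset.Icc 1 n).powersetCard t, (degreeOf H T).choose k ≤
      ∑ T ∈ (Finset.Icc 1 n).powersetCard t, (degreeOf (shift H i j) T).choose k := by
  have mem : ∀ T ∈ (Finset.Icc 1 n).powersetCard t,
      swapSet i j T ∈ (Finset.Icc 1 n).powersetCard t := by
    intro T hT
    rw [Finset.mem_powersetCard] at hT ⊢
    exact ⟨swapSet_subset_Icc hi hj hT.1, (card_swapSet i j T).trans hT.2⟩
  have sum_swap : ∀ g : Finset ℕ → ℕ, ∑ T ∈ (Finset.Icc 1 n).powersetCard t, g (swapSet i j T) =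
      ∑ T ∈ (Finset.Icc 1 n).powersetCard t, g T := fun g =>
    Finset.sum_nbij' (swapSet i j) (swapSet i j) mem mem
      (fun T _ => swapSet_swapSet i j T) (fun T _ => swapSet_swapSet i j T) (fun _ _ => rfl)
  have h := Finset.sum_le_sum fun T (_ : T ∈ (Finset.Icc 1 n).powersetCard t) =>
    choose_degreeOf_le H i j k T
  rw [Finset.sum_add_distrib, Finset.sum_add_distrib,
    sum_swap fun T => (degreeOf H T).choose k,
    sum_swap fun T => (degreeOf (shift H i j) T).choose k] at h
  omega

/-- Every sunflower with at least two petals has a unique core. -/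
theorem sunCount_eq_sum_choose {n r k : ℕ} (hr : 1 ≤ r) (hk : 2 ≤ k) {H : Finset (Finset ℕ)}
    (hH : IsRGraph n r H) :
    sunCount (r - 1) k H =
      ∑ T ∈ (Finset.Icc 1 n).powersetCard (r - 1), (degreeOf H T).choose k := by
  have inter_eq : ∀ T : Finset ℕ, T.card = r - 1 → ∀ e ∈ H.filter (T ⊆ ·),
      ∀ f ∈ H.filter (T ⊆ ·), e ≠ f → e ∩ f = T := by
    intro T hT e he f hf hne
    rw [Finset.mem_filter] at he hf
    refine (Finset.eq_of_subset_of_card_le (Finset.subset_inter he.2 hf.2) ?_).symm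
    by_contra! hlt
    have hef : e ∩ f = e := Finset.eq_of_subset_of_card_le Finset.inter_subset_left
      (by rw [(hH e he.1).2]; omega)
    exact hne (Finset.eq_of_subset_of_card_le (Finset.inter_eq_left.1 hef)
      (by rw [(hH e he.1).2, (hH f hf.1).2]))
  have exists_ne : ∀ F : Finset (Finset ℕ), F.card = k → ∀ e ∈ F, ∃ f ∈ F, f ≠ e :=
    fun F hF e _ => Finset.exists_mem_ne (by omega) e
  have eq_biUnion : ((H.powersetCard k).filter fun F => ∃ T : Finset ℕ, T.card = r - 1 ∧
      ∀ e ∈ F, ∀ f ∈ F, e ≠ f → e ∩ f = T) =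
      ((Finset.Icc 1 n).powersetCard (r - 1)).biUnion
        fun T => (H.filter (T ⊆ ·)).powersetCard k := by
    ext F
    simp only [Finset.mem_filter, Finset.mem_biUnion, Finset.mem_powersetCard]
    constructor
    · rintro ⟨⟨hFH, hF⟩, T, hT, h⟩
      have core_subset : ∀ e ∈ F, T ⊆ e := by
        intro e he
        obtain ⟨f, hf, hne⟩ := exists_ne F hF e he
        rw [← h e he f hf hne.symm]
        exact Finset.inter_subset_left
      obtain ⟨e, he⟩ : F.Nonempty := Finset.card_pos.1 (by omega)
      exact ⟨T, ⟨(core_subset e he).trans (hH e (hFH he)).1, hT⟩,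
        fun f hf => Finset.mem_filter.2 ⟨hFH hf, core_subset f hf⟩, hF⟩
    · rintro ⟨T, ⟨_, hT⟩, hFH, hF⟩
      exact ⟨⟨hFH.trans (Finset.filter_subset _ _), hF⟩, T, hT,
        fun e he f hf => inter_eq T hT e (hFH he) f (hFH hf)⟩
  unfold sunCount
  rw [eq_biUnion, Finset.card_biUnion]
  · simp only [Finset.card_powersetCard, degreeOf]
  · intro T hT T' hT' hne
    refine Finset.disjoint_left.2 fun F hF hF' => ?_
    rw [Finset.mem_coe, Finset.mem_powersetCard] at hT hT'
    rw [Finset.mem_powersetCard] at hF hF'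
    obtain ⟨e, he⟩ : F.Nonempty := Finset.card_pos.1 (by omega)
    obtain ⟨f, hf, hfe⟩ := exists_ne F hF.2 e he
    exact hne ((inter_eq T hT.2 f (hF.1 hf) e (hF.1 he) hfe).symm.trans
      (inter_eq T' hT'.2 f (hF'.1 hf) e (hF'.1 he) hfe))

theorem sunCount_one (t : ℕ) (H : Finset (Finset ℕ)) : sunCount t 1 H = H.card := by
  unfold sunCount
  rw [Finset.filter_true_of_mem, Finset.card_powersetCard, Nat.choose_one_right]
  intro F hF
  obtain ⟨a, rfl⟩ := Finset.card_eq_one.1 (Finset.mem_powersetCard.1 hF).2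
  refine ⟨Finset.range t, Finset.card_range t, fun e he f hf hne => ?_⟩
  rw [Finset.mem_singleton] at he hf
  exact absurd (he.trans hf.symm) hne

theorem shift_sunCount_mono (n r k : ℕ) (hr : 2 ≤ r) (hk : 1 ≤ k)
    (H : Finset (Finset ℕ)) (hH : IsRGraph n r H)
    (i j : ℕ) (hi : 1 ≤ i) (hij : i < j) (hj : j ≤ n) :
    sunCount (r - 1) k H ≤ sunCount (r - 1) k (shift H i j) := by
  have hi' : i ∈ Finset.Icc 1 n := Finset.mem_Icc.2 ⟨hi, by omega⟩
  have hj' : j ∈ Finset.Icc 1 n := Finset.mem_Icc.2 ⟨by omega, hj⟩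
  obtain rfl | hk := hk.eq_or_lt
  · rw [sunCount_one, sunCount_one, card_shift]
  · rw [sunCount_eq_sum_choose (by omega) hk hH,
      sunCount_eq_sum_choose (by omega) hk (hH.shift hi' hj')]
    exact sum_choose_degreeOf_le H (r - 1) k hi' hj'
end

section
/- Let r ≥ 2, k ≥ 2, let H be an r-graph on [n], and let i ∈ [n]. Then (k-1)·N(S_{r-1,k}^r, H) ≤ (k-1)·N(S_{r-1,k}^r, H − {i}) + (k-1)·N(S_{r-2,k}^{r-1}, L_i(H)) + r·e(H − {i})·C(n-r-1, k-2), where C(a,b) denotes the binomial coefficient (with C(a,b) = 0 when a < b). -/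
open Finset

open scoped Classical

/-- `F` is a sunflower with core of size `t`. -/
def IsSunflower (t : ℕ) (F : Finset (Finset ℕ)) : Prop :=
  ∃ T : Finset ℕ, T.card = t ∧ ∀ e ∈ F, ∀ f ∈ F, e ≠ f → e ∩ f = T

/-- The `k`-petal sunflowers of `H` that have a petal through `i` and a petal avoiding `i`. -/
noncomputable def mixedSunflowers (t k : ℕ) (H : Finset (Finset ℕ)) (i : ℕ) :
    Finset (Finset (Finset ℕ)) :=
  (H.powersetCard k).filter fun F =>
    IsSunflower t F ∧ (∃ e ∈ F, i ∈ e) ∧ ∃ f ∈ F, i ∉ f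

theorem injOn_erase_of_mem (i : ℕ) : Set.InjOn (fun e : Finset ℕ => e.erase i) {e | i ∈ e} := by
  intro e he f hf h
  have h' : e.erase i = f.erase i := h
  rw [← insert_erase (show i ∈ e from he), h', insert_erase (show i ∈ f from hf)]

theorem card_sunflowers_through_le (t k : ℕ) (hk : 2 ≤ k) (H : Finset (Finset ℕ)) (i : ℕ) :
    ((H.powersetCard k).filter fun F => IsSunflower t F ∧ ∀ e ∈ F, i ∈ e).card ≤
      sunCount (t - 1) k (link H i) := by
  unfold sunCount
  apply card_le_card_of_injOn fun F => F.image fun e => e.erase i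
  · intro F hF
    obtain ⟨hF, ⟨T, hT, hsun⟩, hi⟩ := mem_filter.1 hF
    obtain ⟨hFH, hFk⟩ := mem_powersetCard.1 hF
    refine mem_filter.2 ⟨mem_powersetCard.2 ⟨?_, ?_⟩, T.erase i, ?_, ?_⟩
    · exact image_subset_image fun e he => mem_filter.2 ⟨hFH he, hi e he⟩
    · rw [card_image_of_injOn ((injOn_erase_of_mem i).mono fun e he => hi e he), hFk]
    · obtain ⟨e, he, f, hf, hef⟩ := one_lt_card.1 (show 1 < F.card by omega)
      rw [card_erase_of_mem, hT]
      rw [← hsun e he f hf hef]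
      exact mem_inter.2 ⟨hi e he, hi f hf⟩
    · intro e' he' f' hf' hne
      obtain ⟨e, he, rfl⟩ := mem_image.1 he'
      obtain ⟨f, hf, rfl⟩ := mem_image.1 hf'
      rw [← hsun e he f hf fun h => hne (by rw [h])]
      ext a
      simp only [mem_inter, mem_erase]
      tauto
  · intro F hF G hG h
    have hFi := (mem_filter.1 hF).2.2
    have hGi := (mem_filter.1 hG).2.2
    exact ((injOn_erase_of_mem i).image_eq_image_iff (s₁ := (F : Set (Finset ℕ)))
      (s₂ := (G : Set (Finset ℕ))) hFi hGi).1 (by exact_mod_cast h) |> coe_injective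

theorem sunCount_le_add_mixedSunflowers (t k : ℕ) (hk : 2 ≤ k) (H : Finset (Finset ℕ)) (i : ℕ) :
    sunCount t k H ≤ sunCount t k (deleteVertex H i) + sunCount (t - 1) k (link H i) +
      (mixedSunflowers t k H i).card := by
  refine le_trans ?_ (Nat.add_le_add_right
    (Nat.add_le_add_left (card_sunflowers_through_le t k hk H i) _) _)
  unfold sunCount
  refine le_trans (card_le_card fun F hF => ?_)
    ((card_union_le _ _).trans (Nat.add_le_add_right (card_union_le _ _) _))
  obtain ⟨hF, hsun⟩ := mem_filter.1 hF
  by_cases h1 : ∀ e ∈ F, i ∈ e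
  · exact mem_union_left _ (mem_union_right _ (mem_filter.2 ⟨hF, hsun, h1⟩))
  by_cases h2 : ∀ e ∈ F, i ∉ e
  · refine mem_union_left _ (mem_union_left _ (mem_filter.2 ⟨?_, hsun⟩))
    obtain ⟨hFH, hFk⟩ := mem_powersetCard.1 hF
    exact mem_powersetCard.2 ⟨fun e he => mem_filter.2 ⟨hFH he, h2 e he⟩, hFk⟩
  · push Not at h1 h2
    exact mem_union_right _ (mem_filter.2 ⟨hF, hsun, h2, h1⟩)

theorem card_petals_avoiding {t k : ℕ} {H : Finset (Finset ℕ)} {i : ℕ} {F : Finset (Finset ℕ)}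
    (hF : F ∈ mixedSunflowers t k H i) : (F.filter fun f => i ∉ f).card = k - 1 := by
  obtain ⟨hF, ⟨T, -, hsun⟩, ⟨e, he, hie⟩, f, hf, hif⟩ := mem_filter.1 hF
  have hiT : i ∉ T := by
    rw [← hsun e he f hf fun h => hif (h ▸ hie)]
    exact fun h => hif (mem_inter.1 h).2
  have : (F.filter fun f => i ∉ f) = F.erase e := by
    ext g
    simp only [mem_filter, mem_erase]
    constructor
    · rintro ⟨hg, hig⟩
      exact ⟨fun h => hig (h ▸ hie), hg⟩
    · rintro ⟨hge, hg⟩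
      refine ⟨hg, fun hig => hiT ?_⟩
      rw [← hsun g hg e he hge]
      exact mem_inter.2 ⟨hig, hie⟩
  rw [this, card_erase_of_mem he, (mem_powersetCard.1 hF).2]

theorem exists_insert_eq_of_card {T e : Finset ℕ} {r : ℕ} (hr : 1 ≤ r) (hTe : T ⊆ e)
    (hT : T.card = r - 1) (he : e.card = r) : ∃ y ∉ T, insert y T = e := by
  have := (exists_eq_insert_iff (s := T) (t := e)).2 ⟨hTe, by omega⟩
  obtain ⟨y, hy, h⟩ := this
  exact ⟨y, hy, h⟩

/-- A mixed sunflower is determined by a petal `f` avoiding `i`, the vertex of `f` outside the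
core, and the `k - 2` vertices that complete the core to the other petals avoiding `i`. -/
theorem exists_eq_image_insert {n r k : ℕ} (hr : 1 ≤ r) {H : Finset (Finset ℕ)}
    (hH : IsRGraph n r H) {i : ℕ} {F : Finset (Finset ℕ)}
    (hF : F ∈ mixedSunflowers (r - 1) k H i) {f : Finset ℕ} (hf : f ∈ F) (hif : i ∉ f) :
    ∃ x ∈ f, ∃ X ∈ (Icc 1 n \ insert i f).powersetCard (k - 2),
      (insert i (insert x X)).image (fun y => insert y (f.erase x)) = F := by
  obtain ⟨hF, ⟨T, hT, hsun⟩, ⟨e, he, hie⟩, -⟩ := mem_filter.1 hF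
  obtain ⟨hFH, hFk⟩ := mem_powersetCard.1 hF
  have hef : e ≠ f := fun h => hif (h ▸ hie)
  have hTef := hsun e he f hf hef
  have hTe : T ⊆ e := hTef ▸ inter_subset_left
  have hTf : T ⊆ f := hTef ▸ inter_subset_right
  have hiT : i ∉ T := fun h => hif (hTf h)
  have hpetal : ∀ g ∈ F, ∃ y ∉ T, insert y T = g := by
    intro g hg
    refine exists_insert_eq_of_card hr ?_ hT (hH g (hFH hg)).2
    by_cases hgf : g = f
    · rwa [hgf]
    · exact hsun g hg f hf hgf ▸ inter_subset_left
  obtain ⟨x, hxT, hxf⟩ := hpetal f hf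
  have hie' : insert i T = e := by
    obtain ⟨y, hy, h⟩ := hpetal e he
    have : i = y := (mem_insert.1 (h ▸ hie)).resolve_right hiT
    rwa [this]
  have hxi : i ≠ x := fun h => hif (by rw [h, ← hxf]; exact mem_insert_self _ _)
  have herase : f.erase x = T := by rw [← hxf, erase_insert hxT]
  set X := (Icc 1 n \ insert i f).filter fun y => insert y T ∈ F with hX
  have hXf : ∀ y ∈ X, y ≠ i ∧ y ∉ f := by
    intro y hy
    have := (mem_sdiff.1 (mem_filter.1 hy).1).2
    simpa [not_or] using this
  have hxmem : x ∈ f := by rw [← hxf]; exact mem_insert_self _ _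
  have himage : (insert i (insert x X)).image (fun y => insert y T) = F := by
    ext g
    simp only [mem_image, mem_insert]
    constructor
    · rintro ⟨y, rfl | rfl | hy, rfl⟩
      · rwa [hie']
      · rwa [hxf]
      · exact (mem_filter.1 hy).2
    · intro hg
      obtain ⟨y, hy, rfl⟩ := hpetal g hg
      refine ⟨y, ?_, rfl⟩
      by_cases hyi : y = i
      · exact Or.inl hyi
      by_cases hyx : y = x
      · exact Or.inr (Or.inl hyx)
      refine Or.inr (Or.inr (mem_filter.2 ⟨mem_sdiff.2 ⟨?_, ?_⟩, hg⟩))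
      · exact (hH _ (hFH hg)).1 (mem_insert_self _ _)
      · rw [← hxf]
        simp [hyi, hyx, hy]
  have hinj : Set.InjOn (fun y => insert y T) (insert i (insert x X) : Finset ℕ) := by
    have hout : ∀ y ∈ insert i (insert x X), y ∉ T := by
      intro y hy
      rcases mem_insert.1 hy with rfl | hy
      · exact hiT
      rcases mem_insert.1 hy with rfl | hy
      · exact hxT
      · exact fun h => (hXf y hy).2 (hTf h)
    intro y hy z _ h
    have h' : insert y T = insert z T := h
    exact (mem_insert.1 (h' ▸ mem_insert_self y T)).resolve_right (hout y hy)
  have hcard : X.card + 2 = k := by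
    rw [← hFk, ← himage, card_image_of_injOn hinj, card_insert_of_notMem, card_insert_of_notMem]
    · exact fun h => (hXf x h).2 hxmem
    · exact fun h => (mem_insert.1 h).elim hxi fun h => (hXf i h).1 rfl
  refine ⟨x, hxmem, X, mem_powersetCard.2 ⟨filter_subset _ _, by omega⟩, ?_⟩
  rw [herase, himage]

theorem mul_card_mixedSunflowers_le {n r k : ℕ} (hr : 1 ≤ r) {H : Finset (Finset ℕ)}
    (hH : IsRGraph n r H) {i : ℕ} (hi : i ∈ Icc 1 n) :
    (k - 1) * (mixedSunflowers (r - 1) k H i).card ≤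
      r * (deleteVertex H i).card * Nat.choose (n - r - 1) (k - 2) := by
  set P := (mixedSunflowers (r - 1) k H i).sigma fun F => F.filter fun f => i ∉ f with hP
  set Q := (deleteVertex H i).sigma fun f =>
    f ×ˢ (Icc 1 n \ insert i f).powersetCard (k - 2) with hQ
  have hPcard : P.card = (k - 1) * (mixedSunflowers (r - 1) k H i).card := by
    rw [hP, card_sigma, sum_congr rfl fun F hF => card_petals_avoiding hF, sum_const,
      smul_eq_mul, mul_comm]
  have hQcard : Q.card = r * (deleteVertex H i).card * Nat.choose (n - r - 1) (k - 2) := by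
    have hfiber : ∀ f ∈ deleteVertex H i,
        (f ×ˢ (Icc 1 n \ insert i f).powersetCard (k - 2)).card =
          r * Nat.choose (n - r - 1) (k - 2) := by
      intro f hf
      obtain ⟨hfH, hif⟩ := mem_filter.1 hf
      obtain ⟨hfn, hfr⟩ := hH f hfH
      rw [card_product, card_powersetCard, card_sdiff_of_subset (insert_subset hi hfn),
        card_insert_of_notMem hif, hfr, Nat.card_Icc, Nat.add_sub_cancel, Nat.sub_sub]
    rw [hQ, card_sigma, sum_congr rfl hfiber, sum_const, smul_eq_mul]
    ring
  rw [← hPcard, ← hQcard]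
  refine le_trans (card_le_card ?_) (card_image_le (s := Q)
    (f := fun q => (⟨(insert i (insert q.2.1 q.2.2)).image
      (fun y => insert y (q.1.erase q.2.1)), q.1⟩ : Σ _ : Finset (Finset ℕ), Finset ℕ)))
  rintro ⟨F, f⟩ hFf
  obtain ⟨hF, hf⟩ := mem_sigma.1 hFf
  obtain ⟨hf, hif⟩ := mem_filter.1 hf
  obtain ⟨x, hx, X, hX, h⟩ := exists_eq_image_insert hr hH hF hf hif
  have hfH : f ∈ H := (mem_powersetCard.1 (mem_filter.1 hF).1).1 hf
  exact mem_image.2 ⟨⟨f, x, X⟩, mem_sigma.2 ⟨mem_filter.2 ⟨hfH, hif⟩, mem_product.2 ⟨hx, hX⟩⟩,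
    by simp only [h]⟩

theorem sunCount_delete_link_bound (n r k : ℕ) (hr : 2 ≤ r) (hk : 2 ≤ k)
    (H : Finset (Finset ℕ)) (hH : IsRGraph n r H) (i : ℕ) (hi : i ∈ Finset.Icc 1 n) :
    (k - 1) * sunCount (r - 1) k H ≤
      (k - 1) * sunCount (r - 1) k (deleteVertex H i) +
      (k - 1) * sunCount (r - 2) k (link H i) +
      r * (deleteVertex H i).card * Nat.choose (n - r - 1) (k - 2) := by
  calc (k - 1) * sunCount (r - 1) k H
      ≤ (k - 1) * (sunCount (r - 1) k (deleteVertex H i) + sunCount (r - 2) k (link H i) +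
          (mixedSunflowers (r - 1) k H i).card) :=
        Nat.mul_le_mul_left _ (sunCount_le_add_mixedSunflowers (r - 1) k hk H i)
    _ ≤ _ := by
        rw [mul_add, mul_add]
        exact Nat.add_le_add_left (mul_card_mixedSunflowers_le (by omega) hH hi) _
end

section
/- Let r ≥ 2, k ≥ 2, s ≥ 1, and let H' be the r-graph on [n] whose hyperedges are all r-subsets of [n] intersecting [(s-1)r+1] in at least two vertices (assume n ≥ (s-1)r+1). Then N(S_{r-1,k}^r, H') ≤ Σ_{j=0}^{r-3} C((s-1)r+1, r-1-j)·C(n-(s-1)r-1, j)·C(n-r+1, k) + ((s-1)r+1)·C(n-(s-1)r-1, r-2)·C((s-1)r+1, k), where C(a,b) denotes the binomial coefficient (with C(a,b) = 0 when a < b). -/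
open Finset

open scoped Classical

/-- Every sunflower is counted at its core. -/
lemma sunCount_le_sum_choose_degreeOf {V : Finset ℕ} {H : Finset (Finset ℕ)} {t k : ℕ}
    (hk : 2 ≤ k) (hH : ∀ e ∈ H, e ⊆ V) :
    sunCount t k H ≤ ∑ T ∈ V.powersetCard t, (degreeOf H T).choose k := by
  have hsub : ((H.powersetCard k).filter fun F => ∃ T : Finset ℕ, T.card = t ∧
      ∀ e ∈ F, ∀ f ∈ F, e ≠ f → e ∩ f = T) ⊆
      (V.powersetCard t).biUnion fun T => (H.filter fun e => T ⊆ e).powersetCard k := by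
    intro F hF
    obtain ⟨hF, T, hT, hcore⟩ := mem_filter.1 hF
    obtain ⟨hFH, hFk⟩ := mem_powersetCard.1 hF
    have hTe : ∀ e ∈ F, T ⊆ e := by
      intro e he
      obtain ⟨f, hf, hfe⟩ := exists_mem_ne (by omega : 1 < F.card) e
      rw [← hcore e he f hf hfe.symm]
      exact inter_subset_left
    obtain ⟨e, he⟩ : F.Nonempty := card_pos.1 (by omega)
    refine mem_biUnion.2 ⟨T, mem_powersetCard.2 ⟨(hTe e he).trans (hH e (hFH he)), hT⟩, ?_⟩
    exact mem_powersetCard.2 ⟨fun f hf => mem_filter.2 ⟨hFH hf, hTe f hf⟩, hFk⟩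
  refine (card_le_card hsub).trans (card_biUnion_le.trans (sum_le_sum fun T _ => ?_))
  rw [card_powersetCard, degreeOf]

lemma degreeOf_le_card {H : Finset (Finset ℕ)} {T X : Finset ℕ}
    (hX : ∀ e ∈ H, T ⊆ e → ∃ x ∈ X, insert x T = e) : degreeOf H T ≤ X.card := by
  refine (card_le_card fun e he => ?_).trans (card_image_le (s := X) (f := fun x => insert x T))
  obtain ⟨he, hTe⟩ := mem_filter.1 he
  exact mem_image.2 (hX e he hTe)

lemma exists_insert_eq_of_card_eq_succ {T e : Finset ℕ} (hTe : T ⊆ e)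
    (hcard : e.card = T.card + 1) : ∃ x ∈ e \ T, insert x T = e := by
  obtain ⟨x, hx, rfl⟩ := exists_eq_insert_iff.2 ⟨hTe, hcard.symm⟩
  exact ⟨x, by simp [hx], rfl⟩

lemma card_filter_card_sdiff_le {V A : Finset ℕ} {t j : ℕ} :
    ((V.powersetCard t).filter fun T => (T \ A).card = j).card ≤
      A.card.choose (t - j) * (V \ A).card.choose j := by
  rw [← card_powersetCard, ← card_powersetCard, ← card_product]
  refine card_le_card_of_injOn (fun T => (T ∩ A, T \ A)) ?_ ?_
  · intro T hT
    obtain ⟨hT, hj⟩ := mem_filter.1 hT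
    obtain ⟨hTV, hTt⟩ := mem_powersetCard.1 hT
    have := card_inter_add_card_sdiff T A
    exact mem_product.2 ⟨mem_powersetCard.2 ⟨inter_subset_right, by dsimp only; omega⟩,
      mem_powersetCard.2 ⟨sdiff_subset_sdiff hTV subset_rfl, hj⟩⟩
  · intro S _ T _ hST
    obtain ⟨h₁, h₂⟩ := Prod.mk.inj hST
    rw [← sdiff_union_inter S A, ← sdiff_union_inter T A, h₁, h₂]

/-- A bound for the sunflowers in the `r`-graph of all `r`-subsets of `V` meeting `A` in at least
two vertices, for `r = q + 2`. -/
lemma sunCount_two_le_card_inter_le {V A : Finset ℕ} {q k : ℕ} (hk : 2 ≤ k) :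
    sunCount (q + 1) k ((V.powersetCard (q + 2)).filter fun e => 2 ≤ (e ∩ A).card) ≤
      (∑ j ∈ range q, A.card.choose (q + 1 - j) * (V \ A).card.choose j *
        (V.card - (q + 1)).choose k) +
      A.card * (V \ A).card.choose q * A.card.choose k := by
  set H := (V.powersetCard (q + 2)).filter fun e => 2 ≤ (e ∩ A).card with hH
  have hmem : ∀ e ∈ H, e ⊆ V ∧ e.card = q + 2 ∧ 2 ≤ (e ∩ A).card := by
    intro e he
    simpa [hH, and_assoc] using he
  have hdeg : ∀ T ∈ V.powersetCard (q + 1), degreeOf H T ≤ V.card - (q + 1) := by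
    intro T hT
    obtain ⟨hTV, hTc⟩ := mem_powersetCard.1 hT
    rw [← hTc, ← card_sdiff_of_subset hTV]
    refine degreeOf_le_card fun e he hTe => ?_
    obtain ⟨heV, hec, -⟩ := hmem e he
    obtain ⟨x, hx, h⟩ := exists_insert_eq_of_card_eq_succ hTe (by omega)
    exact ⟨x, sdiff_subset_sdiff heV subset_rfl hx, h⟩
  have hdegA : ∀ T ∈ V.powersetCard (q + 1), (T \ A).card = q → degreeOf H T ≤ A.card := by
    intro T hT hTq
    obtain ⟨hTV, hTc⟩ := mem_powersetCard.1 hT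
    refine degreeOf_le_card fun e he hTe => ?_
    obtain ⟨heV, hec, he2⟩ := hmem e he
    obtain ⟨x, hx, rfl⟩ := exists_insert_eq_of_card_eq_succ hTe (by omega)
    refine ⟨x, ?_, rfl⟩
    by_contra hxA
    rw [insert_inter_of_notMem hxA] at he2
    have := card_inter_add_card_sdiff T A
    omega
  have hdeg0 : ∀ T ∈ V.powersetCard (q + 1), (T \ A).card = q + 1 → degreeOf H T = 0 := by
    intro T hT hTq
    obtain ⟨hTV, hTc⟩ := mem_powersetCard.1 hT
    refine card_eq_zero.2 (filter_eq_empty_iff.2 fun e he hTe => ?_)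
    obtain ⟨heV, hec, he2⟩ := hmem e he
    have h₁ := card_inter_add_card_sdiff e A
    have h₂ := card_le_card (sdiff_subset_sdiff hTe (subset_refl A))
    omega
  refine (sunCount_le_sum_choose_degreeOf hk fun e he => (hmem e he).1).trans ?_
  rw [← sum_fiberwise_of_maps_to (s := V.powersetCard (q + 1)) (t := range (q + 2))
    (g := fun T => (T \ A).card), sum_range_succ, sum_range_succ]
  · have hlast : ∑ T ∈ (V.powersetCard (q + 1)).filter (fun T => (T \ A).card = q + 1),
        (degreeOf H T).choose k = 0 := by
      refine sum_eq_zero fun T hT => ?_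
      rw [hdeg0 T (mem_filter.1 hT).1 (mem_filter.1 hT).2, Nat.choose_eq_zero_of_lt (by omega)]
    rw [hlast, add_zero]
    refine add_le_add (sum_le_sum fun j _ => ?_) ?_
    · refine (sum_le_card_nsmul _ _ _ fun T hT =>
        Nat.choose_le_choose k (hdeg T (mem_filter.1 hT).1)).trans ?_
      exact Nat.mul_le_mul_right _ card_filter_card_sdiff_le
    · refine (sum_le_card_nsmul _ _ _ fun T hT =>
        Nat.choose_le_choose k (hdegA T (mem_filter.1 hT).1 (mem_filter.1 hT).2)).trans ?_
      refine Nat.mul_le_mul_right _ (card_filter_card_sdiff_le.trans_eq ?_)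
      rw [Nat.add_sub_cancel_left, Nat.choose_one_right]
  · intro T hT
    have := (mem_powersetCard.1 hT).2
    have := card_le_card (sdiff_subset (s := T) (t := A))
    exact mem_range.2 (by omega)

theorem sunCount_twoIntersecting_bound (n r k s : ℕ) (hr : 2 ≤ r) (hk : 2 ≤ k)
    (hs : 1 ≤ s) (hn : (s - 1) * r + 1 ≤ n) :
    sunCount (r - 1) k (((Finset.Icc 1 n).powersetCard r).filter
        fun e => 2 ≤ (e ∩ Finset.Icc 1 ((s - 1) * r + 1)).card) ≤
      (∑ j ∈ Finset.range (r - 2),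
        Nat.choose ((s - 1) * r + 1) (r - 1 - j) *
          Nat.choose (n - (s - 1) * r - 1) j * Nat.choose (n - r + 1) k) +
      ((s - 1) * r + 1) * Nat.choose (n - (s - 1) * r - 1) (r - 2) *
        Nat.choose ((s - 1) * r + 1) k := by
  obtain ⟨q, rfl⟩ := Nat.exists_eq_add_of_le' hr
  set m := (s - 1) * (q + 2) + 1 with hm
  have hA : Icc 1 m ⊆ Icc 1 n := Icc_subset_Icc_right hn
  have hsdiff : (Icc 1 n \ Icc 1 m).card = n - (s - 1) * (q + 2) - 1 := by
    rw [card_sdiff_of_subset hA, Nat.card_Icc, Nat.card_Icc]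
    omega
  have h := sunCount_two_le_card_inter_le (V := Icc 1 n) (A := Icc 1 m) (q := q) hk
  rw [hsdiff, Nat.card_Icc, Nat.card_Icc, Nat.add_sub_cancel, Nat.add_sub_cancel] at h
  refine h.trans (Nat.add_le_add_right (sum_le_sum fun j _ => ?_) _)
  exact Nat.mul_le_mul_left _ (Nat.choose_le_choose k (by omega))
end

section
/- Let r ≥ 2, k ≥ 2 and s ≥ 2. Then there exists a threshold n₁(k,s,r) such that for all n > n₁(k,s,r): N(S_{r-1,k}^r, H') < N(S_{r-1,k}^r, K(n,r,s)), where H' is the r-graph on [n] whose hyperedges are all r-subsets of [n] intersecting [(s-1)r+1] in at least two vertices. -/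
open Finset

open scoped Classical

/-- Every edge of a sunflower with at least two petals contains the core. -/
theorem core_subset_of_mem {F : Finset (Finset ℕ)} {T e : Finset ℕ} (hF : 2 ≤ F.card)
    (hT : ∀ e ∈ F, ∀ f ∈ F, e ≠ f → e ∩ f = T) (he : e ∈ F) : T ⊆ e := by
  obtain ⟨f, hf, hne⟩ := Finset.exists_mem_ne (by omega : 1 < F.card) e
  rw [← hT e he f hf hne.symm]
  exact Finset.inter_subset_left

/-- An `r`-uniform sunflower with core of size `r - 1` and `k ≥ 2` petals spans at most
`r - 1 + k` vertices. -/
theorem card_biUnion_sunflower_le {F : Finset (Finset ℕ)} {T : Finset ℕ} {r : ℕ}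
    (hF : 2 ≤ F.card) (hr : ∀ e ∈ F, e.card = r) (hTr : T.card = r - 1)
    (hT : ∀ e ∈ F, ∀ f ∈ F, e ≠ f → e ∩ f = T) :
    (F.biUnion id).card ≤ r - 1 + F.card := by
  have hsub : F.biUnion id ⊆ T ∪ F.biUnion fun e => e \ T := by
    intro x hx
    simp only [mem_biUnion, id, mem_union, mem_sdiff] at hx ⊢
    obtain ⟨e, he, hxe⟩ := hx
    by_cases hxT : x ∈ T
    · exact Or.inl hxT
    · exact Or.inr ⟨e, he, hxe, hxT⟩
  have hpetal : (F.biUnion fun e => e \ T).card ≤ F.card * 1 := by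
    refine Finset.card_biUnion_le_card_mul _ _ _ fun e he => ?_
    rw [Finset.card_sdiff_of_subset (core_subset_of_mem hF hT he), hr e he, hTr]
    omega
  have h₁ := Finset.card_le_card hsub
  have h₂ := Finset.card_union_le T (F.biUnion fun e => e \ T)
  omega

/-- If all edges meet `A` in at least two vertices, the number of sunflowers is
`O(n ^ (r + k - 3))`. -/
theorem sunCount_le_of_two_le_card_inter {n r k : ℕ} (hr : 2 ≤ r) (hk : 2 ≤ k)
    (hn : r + k ≤ n) (A : Finset ℕ) :
    sunCount (r - 1) k (((Finset.Icc 1 n).powersetCard r).filter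
      fun e => 2 ≤ (e ∩ A).card) ≤
      (A.card.choose 2 * 2 ^ 2 ^ (r + k - 1)) * n ^ (r + k - 3) := by
  have hcover : (((((Finset.Icc 1 n).powersetCard r).filter
      fun e => 2 ≤ (e ∩ A).card).powersetCard k).filter fun F => ∃ T : Finset ℕ,
        T.card = r - 1 ∧ ∀ e ∈ F, ∀ f ∈ F, e ≠ f → e ∩ f = T) ⊆
      (A.powersetCard 2 ×ˢ (Finset.Icc 1 n).powersetCard (r + k - 3)).biUnion
        fun p => (p.1 ∪ p.2).powerset.powerset := by
    intro F hF
    simp only [mem_filter, mem_powersetCard] at hF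
    obtain ⟨⟨hFH, hFk⟩, T, hTr, hT⟩ := hF
    have hedge : ∀ e ∈ F, (e ⊆ Finset.Icc 1 n ∧ e.card = r) ∧ 2 ≤ (e ∩ A).card := by
      intro e he
      simpa using hFH he
    have hcard := card_biUnion_sunflower_le (by omega) (fun e he => (hedge e he).1.2) hTr hT
    obtain ⟨e, he⟩ : F.Nonempty := Finset.card_pos.mp (by omega)
    obtain ⟨p, hpe, hp⟩ := Finset.exists_subset_card_eq (hedge e he).2
    have hpU : p ⊆ F.biUnion id := fun x hx =>
      mem_biUnion.mpr ⟨e, he, (mem_inter.mp (hpe hx)).1⟩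
    have hUn : F.biUnion id \ p ⊆ Finset.Icc 1 n := by
      intro x hx
      obtain ⟨f, hf, hxf⟩ := mem_biUnion.mp (mem_sdiff.mp hx).1
      exact (hedge f hf).1.1 hxf
    have hUp : (F.biUnion id \ p).card ≤ r + k - 3 := by
      rw [Finset.card_sdiff_of_subset hpU]
      omega
    obtain ⟨W, hUW, hWn, hW⟩ := Finset.exists_subsuperset_card_eq hUn hUp
      (by simp only [Nat.card_Icc]; omega)
    simp only [mem_biUnion, mem_product, mem_powersetCard, mem_powerset]
    refine ⟨(p, W), ⟨⟨fun x hx => (mem_inter.mp (hpe hx)).2, hp⟩, hWn, hW⟩, fun f hf => ?_⟩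
    simp only [mem_powerset]
    intro x hx
    by_cases hxp : x ∈ p
    · exact mem_union_left _ hxp
    · exact mem_union_right _ (hUW (mem_sdiff.mpr ⟨mem_biUnion.mpr ⟨f, hf, hx⟩, hxp⟩))
  refine (Finset.card_le_card hcover).trans ?_
  refine (Finset.card_biUnion_le_card_mul _ _ (2 ^ 2 ^ (r + k - 1)) ?_).trans ?_
  · rintro ⟨p, W⟩ hpW
    simp only [mem_product, mem_powersetCard] at hpW
    simp only [Finset.card_powerset]
    have := Finset.card_union_le p W
    exact Nat.pow_le_pow_right (by omega) (Nat.pow_le_pow_right (by omega) (by omega))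
  · simp only [Finset.card_product, Finset.card_powersetCard, Nat.card_Icc, Nat.add_sub_cancel]
    calc A.card.choose 2 * n.choose (r + k - 3) * 2 ^ 2 ^ (r + k - 1)
        = A.card.choose 2 * 2 ^ 2 ^ (r + k - 1) * n.choose (r + k - 3) := by ring
      _ ≤ _ := Nat.mul_le_mul_left _ (Nat.choose_le_pow _ _)

/-- Every `(r + k - 2)`-subset of `{2, …, n}` is, together with the vertex `1`, the vertex set of
some sunflower in the star. -/
theorem choose_le_sunCount_starGraph {n r k s : ℕ} (hr : 2 ≤ r) (hk : 2 ≤ k) (hs : 2 ≤ s) :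
    (n - 1).choose (r + k - 2) ≤ sunCount (r - 1) k (starGraph n r s) := by
  have hcard : (n - 1).choose (r + k - 2) =
      ((Finset.Icc 2 n).powersetCard (r + k - 2)).card := by
    rw [Finset.card_powersetCard, Nat.card_Icc]
    rfl
  rw [hcard]
  refine Finset.card_le_card_of_surjOn (fun F => (F.biUnion id).erase 1) ?_
  intro W hW
  simp only [mem_coe, mem_powersetCard] at hW
  obtain ⟨hWn, hWc⟩ := hW
  obtain ⟨V, hVW, hV⟩ := Finset.exists_subset_card_eq (by omega : r - 2 ≤ W.card)
  have h1W : 1 ∉ W := fun h => by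
    have := Finset.mem_Icc.mp (hWn h)
    omega
  have h1V : 1 ∉ V := fun h => h1W (hVW h)
  have hX : (W \ V).card = k := by
    rw [Finset.card_sdiff_of_subset hVW]
    omega
  have hTc : (insert 1 V).card = r - 1 := by
    rw [Finset.card_insert_of_notMem h1V]
    omega
  have hXT : ∀ x ∈ W \ V, x ∉ insert 1 V := by
    intro x hx
    obtain ⟨hxW, hxV⟩ := mem_sdiff.mp hx
    simp only [mem_insert, not_or]
    exact ⟨fun h => h1W (h ▸ hxW), hxV⟩
  have hWmem : ∀ x ∈ W, 2 ≤ x ∧ x ≤ n := fun x hx => Finset.mem_Icc.mp (hWn hx)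
  refine ⟨(W \ V).image fun x => insert x (insert 1 V), ?_, ?_⟩
  · simp only [mem_coe, mem_filter, mem_powersetCard]
    refine ⟨⟨?_, ?_⟩, insert 1 V, hTc, ?_⟩
    · intro e he
      obtain ⟨x, hx, rfl⟩ := mem_image.mp he
      simp only [starGraph, mem_filter, mem_powersetCard]
      have hxn := hWmem x (mem_sdiff.mp hx).1
      refine ⟨⟨?_, ?_⟩, 1, ?_⟩
      · intro y hy
        simp only [mem_insert] at hy
        rw [Finset.mem_Icc]
        rcases hy with rfl | rfl | hy
        · omega
        · omega
        · have := hWmem y (hVW hy)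
          omega
      · rw [Finset.card_insert_of_notMem (hXT x hx)]
        omega
      · simp only [mem_inter, mem_insert, Finset.mem_Icc]
        exact ⟨by simp, by omega⟩
    · rw [Finset.card_image_of_injOn, hX]
      intro x hx y hy hxy
      exact (Finset.insert_inj (hXT x hx)).mp hxy
    · intro e he f hf hne
      obtain ⟨x, hx, rfl⟩ := mem_image.mp he
      obtain ⟨y, hy, rfl⟩ := mem_image.mp hf
      have hxy : x ≠ y := fun h => hne (by rw [h])
      have := hXT x hx
      ext z
      simp only [mem_inter, mem_insert] at *
      grind
  · obtain ⟨x₀, hx₀⟩ : (W \ V).Nonempty := Finset.card_pos.mp (by omega)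
    ext z
    simp only [mem_erase, mem_biUnion, mem_image, id]
    constructor
    · rintro ⟨hz, e, ⟨x, hx, rfl⟩, hze⟩
      simp only [mem_insert] at hze
      rcases hze with rfl | rfl | hzV
      · exact (mem_sdiff.mp hx).1
      · exact absurd rfl hz
      · exact hVW hzV
    · intro hz
      refine ⟨fun h => h1W (h ▸ hz), ?_⟩
      by_cases hzV : z ∈ V
      · exact ⟨_, ⟨x₀, hx₀, rfl⟩, by simp [hzV]⟩
      · exact ⟨_, ⟨z, mem_sdiff.mpr ⟨hz, hzV⟩, rfl⟩, by simp⟩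

/-- `C * n ^ q` is eventually smaller than `(n - 1).choose (q + 1)`. -/
theorem mul_pow_lt_choose {C q n : ℕ}
    (hn : 2 * (q + 1) + C * ((q + 1).factorial * 2 ^ (q + 1)) < n) :
    C * n ^ q < (n - 1).choose (q + 1) := by
  have hdesc : (n - (q + 1)) ^ (q + 1) ≤ (q + 1).factorial * (n - 1).choose (q + 1) := by
    rw [← Nat.descFactorial_eq_factorial_mul_choose]
    have := Nat.pow_sub_le_descFactorial (n - 1) (q + 1)
    rwa [Nat.sub_add_cancel (by omega)] at this
  have hpow : n ^ (q + 1) ≤ 2 ^ (q + 1) * (n - (q + 1)) ^ (q + 1) := by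
    rw [← mul_pow]
    exact Nat.pow_le_pow_left (by omega) _
  have hnq : 0 < n ^ q := Nat.pow_pos (by omega)
  refine lt_of_mul_lt_mul_left (a := (q + 1).factorial * 2 ^ (q + 1)) ?_ (Nat.zero_le _)
  calc (q + 1).factorial * 2 ^ (q + 1) * (C * n ^ q)
      = C * ((q + 1).factorial * 2 ^ (q + 1)) * n ^ q := by ring
    _ < n * n ^ q := Nat.mul_lt_mul_of_pos_right (by omega) hnq
    _ = n ^ (q + 1) := by ring
    _ ≤ 2 ^ (q + 1) * (n - (q + 1)) ^ (q + 1) := hpow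
    _ ≤ 2 ^ (q + 1) * ((q + 1).factorial * (n - 1).choose (q + 1)) :=
        Nat.mul_le_mul_left _ hdesc
    _ = (q + 1).factorial * 2 ^ (q + 1) * (n - 1).choose (q + 1) := by ring

theorem sunCount_twoIntersecting_lt_star (r k s : ℕ) (hr : 2 ≤ r) (hk : 2 ≤ k)
    (hs : 2 ≤ s) :
    ∃ n₁ : ℕ, ∀ n : ℕ, n > n₁ →
      sunCount (r - 1) k (((Finset.Icc 1 n).powersetCard r).filter
          fun e => 2 ≤ (e ∩ Finset.Icc 1 ((s - 1) * r + 1)).card) <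
      sunCount (r - 1) k (starGraph n r s) := by
  set A := Finset.Icc 1 ((s - 1) * r + 1)
  refine ⟨r + k + (2 * (r + k - 3 + 1) + A.card.choose 2 * 2 ^ 2 ^ (r + k - 1) *
    ((r + k - 3 + 1).factorial * 2 ^ (r + k - 3 + 1))), fun n hn => ?_⟩
  refine (sunCount_le_of_two_le_card_inter hr hk (by omega) A).trans_lt ?_
  refine lt_of_lt_of_le ?_ (choose_le_sunCount_starGraph hr hk hs)
  rw [show r + k - 2 = r + k - 3 + 1 by omega]
  exact mul_pow_lt_choose (by omega)
end

section
/- For all integers r ≥ 3, a with 1 ≤ a ≤ r-2, and k ≥ 2, there exist an integer n, an r-graph H on [n], and indices 1 ≤ i < j ≤ n such that the shifting operation strictly decreases the number of copies of the sunflower S_{a,k}^r: N(S_{a,k}^r, S_{ij}(H)) < N(S_{a,k}^r, H). -/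
open Finset

open scoped Classical

/-- The core `{kb+1, …, kb+a}` of the sunflower built below. -/
def sunflowerCore (a b k : ℕ) : Finset ℕ := Finset.Ioc (k * b) (k * b + a)

/-- The petals `{m+1, m+1+k, …, m+1+(b-1)k}`, for `m < k`, partition `{1, …, kb}`. -/
def sunflowerPetal (b k m : ℕ) : Finset ℕ := (Finset.range b).image fun t => m + 1 + k * t

/-- The hyperedge consisting of the core and the `m`-th petal. -/
noncomputable def sunflowerEdge (a b k m : ℕ) : Finset ℕ :=
  sunflowerPetal b k m ∪ sunflowerCore a b k

theorem sunflowerPetal_subset {b k m : ℕ} (hm : m < k) :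
    sunflowerPetal b k m ⊆ Finset.Icc 1 (k * b) := by
  intro x hx
  obtain ⟨t, ht, rfl⟩ := Finset.mem_image.1 hx
  have h : k * (t + 1) ≤ k * b := Nat.mul_le_mul_left k (Finset.mem_range.1 ht)
  rw [Finset.mem_Icc]
  constructor
  · omega
  · linarith

theorem disjoint_sunflowerPetal_sunflowerCore {a b k m : ℕ} (hm : m < k) :
    Disjoint (sunflowerPetal b k m) (sunflowerCore a b k) := by
  rw [Finset.disjoint_left]
  intro x hx hx'
  have h := Finset.mem_Icc.1 (sunflowerPetal_subset hm hx)
  have h' := Finset.mem_Ioc.1 hx'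
  omega

theorem disjoint_sunflowerPetal {b k m m' : ℕ} (hm : m < k) (hm' : m' < k) (hne : m ≠ m') :
    Disjoint (sunflowerPetal b k m) (sunflowerPetal b k m') := by
  rw [Finset.disjoint_left]
  intro x hx hx'
  obtain ⟨t, -, rfl⟩ := Finset.mem_image.1 hx
  obtain ⟨t', -, h⟩ := Finset.mem_image.1 hx'
  have h' : (m' + k * t') % k = (m + k * t) % k := by
    congr 1
    omega
  rw [Nat.add_mul_mod_self_left, Nat.add_mul_mod_self_left, Nat.mod_eq_of_lt hm,
    Nat.mod_eq_of_lt hm'] at h'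
  exact hne h'.symm

theorem card_sunflowerEdge {a b k m : ℕ} (hm : m < k) :
    (sunflowerEdge a b k m).card = b + a := by
  have hinj : Function.Injective fun t => m + 1 + k * t := fun t t' h =>
    Nat.eq_of_mul_eq_mul_left (by omega) (Nat.add_left_cancel h)
  rw [sunflowerEdge, Finset.card_union_of_disjoint (disjoint_sunflowerPetal_sunflowerCore hm),
    sunflowerPetal, Finset.card_image_of_injective _ hinj, Finset.card_range, sunflowerCore,
    Nat.card_Ioc, Nat.add_sub_cancel_left]

theorem sunflowerEdge_subset {a b k m : ℕ} (hm : m < k) :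
    sunflowerEdge a b k m ⊆ Finset.Icc 1 (k * b + a) := by
  intro x hx
  rw [Finset.mem_Icc]
  rcases Finset.mem_union.1 hx with hx | hx
  · have h := Finset.mem_Icc.1 (sunflowerPetal_subset hm hx)
    omega
  · have h := Finset.mem_Ioc.1 hx
    omega

theorem sunflowerEdge_inter {a b k m m' : ℕ} (hm : m < k) (hm' : m' < k) (hne : m ≠ m') :
    sunflowerEdge a b k m ∩ sunflowerEdge a b k m' = sunflowerCore a b k := by
  rw [sunflowerEdge, sunflowerEdge, ← Finset.inter_union_distrib_right,
    Finset.disjoint_iff_inter_eq_empty.1 (disjoint_sunflowerPetal hm hm' hne),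
    Finset.empty_union]

theorem mem_sunflowerEdge {a b k m t : ℕ} (ht : t < b) :
    m + 1 + k * t ∈ sunflowerEdge a b k m :=
  Finset.mem_union_left _ (Finset.mem_image_of_mem _ (Finset.mem_range.2 ht))

theorem notMem_sunflowerEdge {a b k m m' t : ℕ} (hm : m < k) (hm' : m' < k) (hne : m ≠ m')
    (ht : t < b) : m + 1 + k * t ∉ sunflowerEdge a b k m' := by
  have hx : m + 1 + k * t ∈ sunflowerPetal b k m :=
    Finset.mem_image_of_mem _ (Finset.mem_range.2 ht)
  intro h
  rcases Finset.mem_union.1 h with h | h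
  · exact Finset.disjoint_left.1 (disjoint_sunflowerPetal hm hm' hne) hx h
  · exact Finset.disjoint_left.1 (disjoint_sunflowerPetal_sunflowerCore hm) hx h

theorem injOn_sunflowerEdge {a b k : ℕ} (hb : 0 < b) :
    Set.InjOn (sunflowerEdge a b k) (Finset.range k) := by
  intro m hm m' hm' h
  by_contra hne
  refine notMem_sunflowerEdge (a := a) (Finset.mem_range.1 hm) (Finset.mem_range.1 hm') hne hb ?_
  rw [← h]
  exact mem_sunflowerEdge hb

theorem sunCount_pos_of_sunflower {t : ℕ} {H : Finset (Finset ℕ)} {T : Finset ℕ}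
    (hT : T.card = t) (h : ∀ e ∈ H, ∀ f ∈ H, e ≠ f → e ∩ f = T) : 0 < sunCount t H.card H :=
  Finset.card_pos.2 ⟨H, Finset.mem_filter.2
    ⟨Finset.mem_powersetCard.2 ⟨Finset.Subset.refl H, rfl⟩, T, hT, h⟩⟩

theorem sunCount_eq_zero {t k : ℕ} {H : Finset (Finset ℕ)} (hcard : H.card ≤ k)
    {e f : Finset ℕ} (he : e ∈ H) (hf : f ∈ H) (hne : e ≠ f) (hef : (e ∩ f).card ≠ t) :
    sunCount t k H = 0 := by
  refine Finset.card_eq_zero.2 (Finset.filter_eq_empty_iff.2 ?_)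
  rintro F hF ⟨T, hT, h⟩
  obtain ⟨hFH, hFk⟩ := Finset.mem_powersetCard.1 hF
  obtain rfl : F = H := Finset.eq_of_subset_of_card_le hFH (hcard.trans hFk.ge)
  exact hef (by rw [h e he f hf hne, hT])

theorem shift_can_decrease_small_core_sunflowers (r a k : ℕ) (hr : 3 ≤ r)
    (ha1 : 1 ≤ a) (ha2 : a ≤ r - 2) (hk : 2 ≤ k) :
    ∃ (n : ℕ) (H : Finset (Finset ℕ)) (i j : ℕ), IsRGraph n r H ∧
      1 ≤ i ∧ i < j ∧ j ≤ n ∧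
      sunCount a k (shift H i j) < sunCount a k H := by
  obtain ⟨b, rfl⟩ : ∃ b, r = b + a := ⟨r - a, by omega⟩
  have hb : 2 ≤ b := by omega
  have h0k : 0 < k := by omega
  have h1k : 1 < k := by omega
  set E := sunflowerEdge a b k
  set H := (Finset.range k).image E with hH
  have hcard : H.card = k := by
    rw [hH, Finset.card_image_of_injOn (injOn_sunflowerEdge (by omega)), Finset.card_range]
  have hE : ∀ m < k, E m ∈ H := fun m hm => Finset.mem_image_of_mem _ (Finset.mem_range.2 hm)
  have hcore : (sunflowerCore a b k).card = a := by simp [sunflowerCore]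
  have one_mem : 1 ∈ E 0 := mem_sunflowerEdge (t := 0) (by omega)
  have two_mem : 2 ∈ E 1 := mem_sunflowerEdge (t := 0) (by omega)
  have one_notMem : ∀ m < k, m ≠ 0 → 1 ∉ E m := fun m hm hm0 =>
    notMem_sunflowerEdge (t := 0) h0k hm hm0.symm (by omega)
  have two_notMem : 2 ∉ E 0 := notMem_sunflowerEdge (t := 0) h1k h0k one_ne_zero (by omega)
  have second_mem : 1 + 1 + k * 1 ∈ E 1 := mem_sunflowerEdge (by omega)
  have second_notMem : 1 + 1 + k * 1 ∉ E 0 :=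
    notMem_sunflowerEdge h1k h0k one_ne_zero (by omega)
  set e := insert 1 ((E 1).erase 2) with he
  have second_mem' : 1 + 1 + k * 1 ∈ e :=
    Finset.mem_insert_of_mem (Finset.mem_erase.2 ⟨by omega, second_mem⟩)
  have hne : e ≠ E 0 := fun h => second_notMem (h ▸ second_mem')
  have heH : e ∉ H := by
    intro h
    obtain ⟨m, hm, hme⟩ := Finset.mem_image.1 h
    by_cases hm0 : m = 0
    · exact hne (by rw [← hme, hm0])
    · exact one_notMem m (Finset.mem_range.1 hm) hm0 (hme ▸ Finset.mem_insert_self _ _)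
  have he_mem : e ∈ shift H 1 2 := Finset.mem_image.2 ⟨E 1, hE 1 h1k,
    if_pos ⟨two_mem, one_notMem 1 h1k one_ne_zero, heH⟩⟩
  have hE0_mem : E 0 ∈ shift H 1 2 := Finset.mem_image.2 ⟨E 0, hE 0 h0k,
    if_neg fun h => two_notMem h.1⟩
  have hinter : (e ∩ E 0).card ≠ a := by
    rw [he, Finset.insert_inter_of_mem one_mem, Finset.erase_inter,
      sunflowerEdge_inter h1k h0k one_ne_zero, Finset.erase_eq_of_notMem,
      Finset.card_insert_of_notMem, hcore]
    · omega
    · exact fun h => one_notMem 1 h1k one_ne_zero (Finset.mem_union_right _ h)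
    · exact fun h => two_notMem (Finset.mem_union_right _ h)
  refine ⟨k * b + a, H, 1, 2, ?_, le_rfl, one_lt_two, by nlinarith, ?_⟩
  · intro f hf
    obtain ⟨m, hm, rfl⟩ := Finset.mem_image.1 hf
    exact ⟨sunflowerEdge_subset (Finset.mem_range.1 hm), card_sunflowerEdge (Finset.mem_range.1 hm)⟩
  · have hshift : (shift H 1 2).card ≤ k := Finset.card_image_le.trans hcard.le
    rw [sunCount_eq_zero hshift he_mem hE0_mem hne hinter]
    have hpos := sunCount_pos_of_sunflower (H := H) hcore ?_
    · rwa [hcard] at hpos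
    · intro f hf g hg hfg
      obtain ⟨m, hm, rfl⟩ := Finset.mem_image.1 hf
      obtain ⟨m', hm', rfl⟩ := Finset.mem_image.1 hg
      exact sunflowerEdge_inter (Finset.mem_range.1 hm) (Finset.mem_range.1 hm')
        fun h => hfg (by rw [h])
end
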